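/- Assume (H1), (H2), and (H3), that each Gᵢ is continuous, and that s ↦ f(s,y_s) is Lebesgue integrable on [0,τ] for every bounded y : [−r,τ] → ℝⁿ. Then there exists a function z : [−r,τ] → ℝⁿ with sup_{t∈[−r,τ]} ‖z(t) − φ̃(t)‖ ≤ ρ, continuous at every point of [0,τ] except possibly at t₁,…,t_N (where it is left-continuous with right limits), satisfying the integral equations: z(t) = U(t,0)·[φ(0) − g(z_{θ₁},…,z_{θ_q})(0)] + ∫₀ᵗ U(t,s)·f(s,z_s) ds for t ∈ (0,t₁]; z(t) = U(t,sᵢ)·Gᵢ(sᵢ,z(sᵢ)) + ∫_{sᵢ}ᵗ U(t,s)·f(s,z_s) ds for t ∈ (sᵢ,t_{i+1}], i = 1,…,N; z(t) = Gᵢ(t,z(t)) for t ∈ (tᵢ,sᵢ], i = 1,…,N; and z(t) = φ(t) − g(z_{θ₁},…,z_{θ_q})(t) for t ∈ [−r,0]. -/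

import Mathlib

open Matrix MeasureTheory Set Filter

/-- supremum of the norm of `w` over the interval `[a, b]`. -/
noncomputable def supOn {E : Type*} [NormedAddCommGroup E]
    (a b : ℝ) (w : ℝ → E) : ℝ :=
  ⨆ u : Set.Icc a b, ‖w u.1‖

/-- `w` is bounded (in norm) on the interval `[a, b]`. -/
def BddOn {E : Type*} [NormedAddCommGroup E] (a b : ℝ) (w : ℝ → E) : Prop :=
  ∃ C : ℝ, ∀ u ∈ Set.Icc a b, ‖w u‖ ≤ C

open Polynomial in
/-- The determinant of `1 + t A` is a polynomial in `t` of degree at most the dimension. -/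
lemma exists_polynomial_det_one_add_smul {E : Type*} [NormedAddCommGroup E] [NormedSpace ℝ E]
    [FiniteDimensional ℝ E] (A : E →L[ℝ] E) :
    ∃ p : ℝ[X], p.natDegree ≤ Module.finrank ℝ E ∧
      ∀ t : ℝ, p.eval t = (1 + t • A : E →L[ℝ] E).det := by
  set b := Module.finBasis ℝ E
  set B := LinearMap.toMatrix b b (A : E →ₗ[ℝ] E)
  refine ⟨det ((X : ℝ[X]) • B.map C + (1 : Matrix _ _ ℝ).map C), ?_, fun t => ?_⟩
  · simpa using natDegree_det_X_add_C_le B 1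
  · rw [ContinuousLinearMap.det, ← LinearMap.det_toMatrix b, ← Polynomial.coe_evalRingHom,
      RingHom.map_det]
    congr 1
    ext i j
    by_cases h : i = j <;> simp [h, B, LinearMap.toMatrix_one, add_comm] <;> ring

open Polynomial in
/-- Evaluation at `1` of polynomials of bounded degree is an affine combination of evaluations at
points close to zero. -/
lemma exists_affine_combination_eval_one (d : ℕ) {δ : ℝ} (hδ : 0 < δ) :
    ∃ c v : Fin (d + 1) → ℝ, (∀ i, 0 < v i ∧ v i < δ) ∧ ∑ i, c i = 1 ∧
      ∀ p : ℝ[X], p.natDegree ≤ d → p.eval 1 = ∑ i, c i * p.eval (v i) := by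
  set v : Fin (d + 1) → ℝ := fun i => δ / (i.1 + 2)
  have hv : Set.InjOn v (Finset.univ : Finset (Fin (d + 1))) := by
    intro i _ j _ hij
    have h1 : (0 : ℝ) < i.1 + 2 := by positivity
    have h2 : (0 : ℝ) < j.1 + 2 := by positivity
    simp only [v] at hij
    rw [div_eq_div_iff h1.ne' h2.ne'] at hij
    have := mul_left_cancel₀ hδ.ne' hij
    ext
    exact_mod_cast (by linarith : (i.1 : ℝ) = j.1)
  have key : ∀ p : ℝ[X], p.natDegree ≤ d →
      p.eval 1 = ∑ i, (Lagrange.basis Finset.univ v i).eval 1 * p.eval (v i) := by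
    intro p hp
    have := Lagrange.eq_interpolate (f := p) hv (by
      refine lt_of_le_of_lt degree_le_natDegree ?_
      simp only [Finset.card_univ, Fintype.card_fin]
      exact_mod_cast Nat.lt_succ_of_le hp)
    conv_lhs => rw [this]
    simp [Lagrange.interpolate_apply, eval_finsetSum, mul_comm]
  refine ⟨fun i => (Lagrange.basis Finset.univ v i).eval 1, v, fun i => ⟨by positivity, ?_⟩, ?_,
    key⟩
  · simp only [v]
    rw [div_lt_iff₀ (by positivity)]
    nlinarith [(Nat.cast_nonneg i.1 : (0 : ℝ) ≤ i.1)]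
  · simpa using (key 1 (by simp)).symm

section Jacobian

variable {E : Type*} [NormedAddCommGroup E] [NormedSpace ℝ E] [FiniteDimensional ℝ E]

/-- A small Lipschitz perturbation of the identity supported in the unit ball maps the unit ball
bijectively onto itself. -/
lemma injective_and_image_ball_of_lipschitz {h : E → E} {C : NNReal} (hC : LipschitzWith C h)
    (h0 : ∀ x, x ∉ Metric.ball (0 : E) 1 → h x = 0) {t : ℝ} (ht : 0 < t) (htC : t * C < 1) :
    Function.Injective (fun x => x + t • h x) ∧
      (fun x => x + t • h x) '' Metric.ball 0 1 = Metric.ball 0 1 := by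
  have hlip : ∀ x y, ‖t • h x - t • h y‖ ≤ t * C * ‖x - y‖ := by
    intro x y
    rw [← smul_sub, norm_smul, Real.norm_of_nonneg ht.le, mul_assoc]
    exact mul_le_mul_of_nonneg_left (hC.norm_sub_le x y) ht.le
  have hinj : Function.Injective (fun x => x + t • h x) := by
    intro x y hxy
    have h1 : x - y = -(t • h x - t • h y) := by
      have : x + t • h x = y + t • h y := hxy
      rw [neg_sub, sub_eq_sub_iff_add_eq_add, this]
      abel
    have h2 := hlip x y
    have h3 : ‖x - y‖ = ‖t • h x - t • h y‖ := by rw [h1, norm_neg]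
    have h4 : ‖x - y‖ ≤ 0 := by
      by_contra hpos
      push Not at hpos
      nlinarith
    exact sub_eq_zero.1 (norm_le_zero_iff.1 h4)
  have hsurj : Function.Surjective (fun x => x + t • h x) := by
    intro y
    have hc : ContractingWith (NNReal.mk (t * C) (by positivity)) (fun x => y - t • h x) := by
      refine ⟨by exact_mod_cast htC, LipschitzWith.of_dist_le_mul fun a b => ?_⟩
      rw [dist_eq_norm, dist_eq_norm, NNReal.coe_mk]
      have : (y - t • h a) - (y - t • h b) = -(t • h a - t • h b) := by abel
      rw [this, norm_neg]
      exact hlip a b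
    obtain ⟨x, hx, -⟩ := hc.exists_fixedPoint 0 (edist_ne_top _ _)
    exact ⟨x, (eq_add_of_sub_eq hx).symm⟩
  refine ⟨hinj, Set.Subset.antisymm ?_ ?_⟩
  · rintro _ ⟨x, hx, rfl⟩
    by_contra hn
    have : (fun x => x + t • h x) (x + t • h x) = (fun x => x + t • h x) x := by
      simp [h0 _ hn]
    have hfix : x + t • h x = x := hinj this
    simp only [hfix] at hn
    exact hn hx
  · intro y hy
    obtain ⟨x, rfl⟩ := hsurj y
    refine ⟨x, ?_, rfl⟩
    by_contra hn
    simp only [h0 _ hn, smul_zero, add_zero] at hy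
    exact hn hy

variable [MeasurableSpace E] [BorelSpace E]

/-- The integral of the Jacobian determinant of a small perturbation of the identity supported in
the unit ball. -/
lemma integral_det_one_add_smul_of_small {h : E → E} {C : NNReal} (hC : LipschitzWith C h)
    (h0 : ∀ x, x ∉ Metric.ball (0 : E) 1 → h x = 0)
    (hd : ∀ x ∈ Metric.ball (0 : E) 1, DifferentiableAt ℝ h x) (μ : Measure E)
    [μ.IsAddHaarMeasure] :
    ∃ δ > 0, ∀ t : ℝ, 0 < t → t < δ →
      IntegrableOn (fun x => (1 + t • fderiv ℝ h x : E →L[ℝ] E).det) (Metric.ball 0 1) μ ∧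
      ∫ x in Metric.ball 0 1, (1 + t • fderiv ℝ h x : E →L[ℝ] E).det ∂μ
        = μ.real (Metric.ball 0 1) := by
  have hpos : ∀ᶠ X : E →L[ℝ] E in nhds 1, 0 < X.det := by
    refine ContinuousLinearMap.continuous_det.continuousAt.eventually (lt_mem_nhds ?_)
    simp [ContinuousLinearMap.det]
  obtain ⟨ε, hε, hball⟩ := Metric.eventually_nhds_iff.1 hpos
  have hC1 : (0 : ℝ) < C + 1 := by positivity
  refine ⟨min ε 1 / (C + 1), by positivity, fun t ht htδ => ?_⟩
  rw [lt_div_iff₀ hC1] at htδ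
  have ht1 : t * C < 1 := by nlinarith [min_le_right ε 1]
  have ht2 : t * C < ε := by nlinarith [min_le_left ε 1]
  obtain ⟨hinj, himg⟩ := injective_and_image_ball_of_lipschitz hC h0 ht ht1
  have hdet : ∀ x, 0 < (1 + t • fderiv ℝ h x : E →L[ℝ] E).det := by
    intro x
    apply hball
    rw [dist_eq_norm, add_sub_cancel_left, norm_smul, Real.norm_of_nonneg ht.le]
    exact lt_of_le_of_lt (mul_le_mul_of_nonneg_left (norm_fderiv_le_of_lipschitz ℝ hC) ht.le) ht2
  have hder : ∀ x ∈ Metric.ball (0 : E) 1, HasFDerivWithinAt (fun x => x + t • h x)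
      (1 + t • fderiv ℝ h x : E →L[ℝ] E) (Metric.ball 0 1) x := fun x hx =>
    ((hasFDerivAt_id x).add ((hd x hx).hasFDerivAt.const_smul t)).hasFDerivWithinAt
  have hI := integrableOn_image_iff_integrableOn_abs_det_fderiv_smul μ measurableSet_ball hder
    hinj.injOn (fun _ => (1 : ℝ))
  have hII := integral_image_eq_integral_abs_det_fderiv_smul μ measurableSet_ball hder
    hinj.injOn (fun _ => (1 : ℝ))
  rw [himg] at hI hII
  simp only [abs_of_pos (hdet _), smul_eq_mul, mul_one] at hI hII
  refine ⟨hI.1 ?_, ?_⟩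
  · exact integrableOn_const (by exact measure_ball_lt_top.ne)
  · rw [← hII]
    simp

/-- The Jacobian determinant of a Lipschitz map that is the identity outside the unit ball has the
same integral over the ball as that of the identity. -/
lemma integral_det_one_add_fderiv {h : E → E} {C : NNReal} (hC : LipschitzWith C h)
    (h0 : ∀ x, x ∉ Metric.ball (0 : E) 1 → h x = 0)
    (hd : ∀ x ∈ Metric.ball (0 : E) 1, DifferentiableAt ℝ h x) (μ : Measure E)
    [μ.IsAddHaarMeasure] :
    ∫ x in Metric.ball 0 1, (1 + fderiv ℝ h x : E →L[ℝ] E).det ∂μ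
      = μ.real (Metric.ball 0 1) := by
  obtain ⟨δ, hδ, hs⟩ := integral_det_one_add_smul_of_small hC h0 hd μ
  obtain ⟨c, v, hv, hc, hp⟩ := exists_affine_combination_eval_one (Module.finrank ℝ E) hδ
  have key : ∀ A : E →L[ℝ] E, (1 + A : E →L[ℝ] E).det
      = ∑ i, c i * (1 + v i • A : E →L[ℝ] E).det := by
    intro A
    obtain ⟨p, hdeg, heval⟩ := exists_polynomial_det_one_add_smul A
    have := hp p hdeg
    simpa [heval] using this
  rw [integral_congr_ae (ae_of_all _ fun x => key _)]
  rw [integral_finsetSum _ fun i _ => ((hs (v i) (hv i).1 (hv i).2).1.integrable).const_mul _]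
  simp_rw [integral_const_mul, fun i => (hs (v i) (hv i).1 (hv i).2).2]
  rw [← Finset.sum_mul, hc, one_mul]

end Jacobian

/-- Radial retraction of a normed space onto its closed unit ball. -/
noncomputable def radialRetraction {E : Type*} [NormedAddCommGroup E] [NormedSpace ℝ E]
    (x : E) : E :=
  (max 1 ‖x‖)⁻¹ • x

section RadialRetraction

variable {E : Type*} [NormedAddCommGroup E] [NormedSpace ℝ E]

lemma radialRetraction_of_norm_le {x : E} (hx : ‖x‖ ≤ 1) : radialRetraction x = x := by
  simp [radialRetraction, max_eq_left hx]

lemma norm_radialRetraction_of_le {x : E} (hx : 1 ≤ ‖x‖) : ‖radialRetraction x‖ = 1 := by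
  rw [radialRetraction, max_eq_right hx, norm_smul, norm_inv, norm_norm]
  exact inv_mul_cancel₀ (by linarith)

lemma radialRetraction_mem (x : E) : radialRetraction x ∈ Metric.closedBall (0 : E) 1 := by
  rw [mem_closedBall_zero_iff]
  rcases le_total ‖x‖ 1 with h | h
  · rwa [radialRetraction_of_norm_le h]
  · exact (norm_radialRetraction_of_le h).le

lemma lipschitzWith_radialRetraction : LipschitzWith 2 (radialRetraction : E → E) := by
  refine LipschitzWith.of_dist_le_mul fun x y => ?_
  rw [dist_eq_norm, dist_eq_norm]
  have ha : (1 : ℝ) ≤ max 1 ‖x‖ := le_max_left _ _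
  have hb : (1 : ℝ) ≤ max 1 ‖y‖ := le_max_left _ _
  have hab : |max 1 ‖y‖ - max 1 ‖x‖| ≤ ‖x - y‖ := by
    rw [max_comm 1 ‖y‖, max_comm 1 ‖x‖, norm_sub_rev x y]
    exact (abs_max_sub_max_le_abs _ _ _).trans (abs_norm_sub_norm_le _ _)
  have hya : (max 1 ‖y‖)⁻¹ * ‖y‖ ≤ 1 := by
    rw [inv_mul_le_one₀ (by linarith)]
    exact le_max_right _ _
  have hsplit : radialRetraction x - radialRetraction y = (max 1 ‖x‖)⁻¹ • (x - y)
      + ((max 1 ‖x‖)⁻¹ * (max 1 ‖y‖ - max 1 ‖x‖)) • (max 1 ‖y‖)⁻¹ • y := by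
    rw [radialRetraction, radialRetraction, smul_sub, smul_smul]
    have : (max 1 ‖x‖)⁻¹ * (max 1 ‖y‖ - max 1 ‖x‖) * (max 1 ‖y‖)⁻¹
        = (max 1 ‖x‖)⁻¹ - (max 1 ‖y‖)⁻¹ := by
      field_simp
    rw [this, sub_smul]
    abel
  have hia : (max 1 ‖x‖)⁻¹ ≤ 1 := inv_le_one_of_one_le₀ ha
  have hia0 : 0 ≤ (max 1 ‖x‖)⁻¹ := by positivity
  rw [hsplit]
  refine (norm_add_le _ _).trans ?_
  rw [norm_smul, norm_smul, norm_smul, norm_mul, Real.norm_of_nonneg hia0,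
    Real.norm_of_nonneg (by positivity : 0 ≤ (max 1 ‖y‖)⁻¹), Real.norm_eq_abs]
  have h1 : (max 1 ‖x‖)⁻¹ * ‖x - y‖ ≤ 1 * ‖x - y‖ := by gcongr
  have h2 : (max 1 ‖x‖)⁻¹ * |max 1 ‖y‖ - max 1 ‖x‖| * ((max 1 ‖y‖)⁻¹ * ‖y‖)
      ≤ 1 * ‖x - y‖ * 1 := by gcongr
  push_cast
  linarith

end RadialRetraction

section Brouwer

variable {E : Type*} [NormedAddCommGroup E] [InnerProductSpace ℝ E]

variable [FiniteDimensional ℝ E] in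
/-- A map whose values near `x` have norm one has singular derivative at `x`. -/
lemma det_fderiv_eq_zero_of_norm_eq_one {F : E → E} {F' : E →L[ℝ] E} {x : E}
    (hF : HasFDerivAt F F' x) (h1 : ∀ᶠ y in nhds x, ‖F y‖ = 1) : F'.det = 0 := by
  have hsq : HasFDerivAt (fun y => inner ℝ (F y) (F y)) _ x := hF.inner ℝ hF
  have hconst : HasFDerivAt (fun y => inner ℝ (F y) (F y)) (0 : E →L[ℝ] ℝ) x := by
    refine (hasFDerivAt_const (1 : ℝ) x).congr_of_eventuallyEq ?_
    filter_upwards [h1] with y hy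
    rw [real_inner_self_eq_norm_sq, hy, one_pow]
  have horth : ∀ v, inner ℝ (F x) (F' v) = 0 := by
    intro v
    have := congrArg (fun L : E →L[ℝ] ℝ => L v) (hsq.unique hconst)
    simp [fderivInnerCLM_apply, real_inner_comm] at this
    linarith
  by_contra hdet
  have hsurj : Function.Surjective (F' : E →ₗ[ℝ] E) :=
    (LinearMap.equivOfDetNeZero (F' : E →ₗ[ℝ] E) hdet).surjective
  obtain ⟨v, hv⟩ := hsurj (F x)
  have h2 := horth v
  rw [show F' v = F x from hv, real_inner_self_eq_norm_sq, h1.self_of_nhds] at h2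
  norm_num at h2

/-- The displacement along the ray from `g x` through `x` up to the unit sphere. -/
noncomputable def sphereDisplacement (g : E → E) (x : E) : E :=
  ((√(inner ℝ x (x - g x) ^ 2 + ‖x - g x‖ ^ 2 * (1 - ‖x‖ ^ 2)) - inner ℝ x (x - g x))
    / ‖x - g x‖ ^ 2) • (x - g x)

lemma inner_sub_pos_of_norm_lt_one {x y : E} (hx : ‖x‖ = 1) (hy : ‖y‖ < 1) :
    0 < inner ℝ x (x - y) := by
  rw [inner_sub_right, real_inner_self_eq_norm_sq, hx]
  have := real_inner_le_norm x y
  rw [hx] at this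
  linarith

lemma sphereDisplacement_of_norm_eq_one {g : E → E} {x : E} (hx : ‖x‖ = 1) (hg : ‖g x‖ < 1) :
    sphereDisplacement g x = 0 := by
  have := (inner_sub_pos_of_norm_lt_one hx hg).le
  simp [sphereDisplacement, hx, Real.sqrt_sq this]

lemma norm_add_sphereDisplacement {g : E → E} {x : E} (hx : ‖x‖ ≤ 1) (hne : g x ≠ x) :
    ‖x + sphereDisplacement g x‖ = 1 := by
  have hd : 0 < ‖x - g x‖ := norm_pos_iff.2 (sub_ne_zero.2 hne.symm)
  have hdisc : 0 ≤ inner ℝ x (x - g x) ^ 2 + ‖x - g x‖ ^ 2 * (1 - ‖x‖ ^ 2) := by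
    have : ‖x‖ ^ 2 ≤ 1 := pow_le_one₀ (norm_nonneg _) hx
    have : 0 ≤ 1 - ‖x‖ ^ 2 := by linarith
    positivity
  have hs := Real.sq_sqrt hdisc
  rw [← sq_eq_sq₀ (norm_nonneg _) zero_le_one, sphereDisplacement, norm_add_sq_real,
    inner_smul_right, norm_smul, mul_pow, Real.norm_eq_abs, sq_abs]
  field_simp
  linear_combination hs

lemma contDiffAt_sphereDisplacement {g : E → E} (hg : ContDiff ℝ 1 g) {x : E} (hx : ‖x‖ ≤ 1)
    (hgx : ‖g x‖ < 1) (hne : g x ≠ x) : ContDiffAt ℝ 1 (sphereDisplacement g) x := by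
  have hd : 0 < ‖x - g x‖ := norm_pos_iff.2 (sub_ne_zero.2 hne.symm)
  have hdisc : 0 < inner ℝ x (x - g x) ^ 2 + ‖x - g x‖ ^ 2 * (1 - ‖x‖ ^ 2) := by
    rcases hx.lt_or_eq with h | h
    · have : ‖x‖ ^ 2 < 1 := pow_lt_one₀ (norm_nonneg _) h two_ne_zero
      have : 0 < 1 - ‖x‖ ^ 2 := by linarith
      positivity
    · have := inner_sub_pos_of_norm_lt_one h hgx
      rw [h]
      simpa using pow_pos this 2
  have hgd : ContDiffAt ℝ 1 (fun y => y - g y) x := (contDiff_id.sub hg).contDiffAt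
  have hin : ContDiffAt ℝ 1 (fun y => inner ℝ y (y - g y)) x := contDiffAt_id.inner ℝ hgd
  have hnd : ContDiffAt ℝ 1 (fun y => ‖y - g y‖ ^ 2) x := hgd.norm_sq ℝ
  have hnx : ContDiffAt ℝ 1 (fun y : E => ‖y‖ ^ 2) x := contDiffAt_id.norm_sq ℝ
  exact (((((hin.pow 2).add (hnd.mul (contDiffAt_const.sub hnx))).sqrt hdisc.ne').sub hin).div hnd
    (by positivity)).smul hgd

variable [FiniteDimensional ℝ E] [MeasurableSpace E] [BorelSpace E]

/-- Brouwer's fixed point theorem for continuously differentiable maps. -/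
lemma exists_fixedPoint_of_contDiff {g : E → E} (hg : ContDiff ℝ 1 g) (hg1 : ∀ x, ‖g x‖ < 1) :
    ∃ x, g x = x := by
  by_contra! hne
  have hk : ∀ x : E, ‖x‖ ≤ 1 → ContDiffAt ℝ 1 (sphereDisplacement g) x := fun x hx =>
    contDiffAt_sphereDisplacement hg hx (hg1 x) (hne x)
  obtain ⟨C, hC⟩ := ContDiffOn.exists_lipschitzOnWith (s := Metric.closedBall (0 : E) 1)
    (fun x hx => (hk x (mem_closedBall_zero_iff.1 hx)).contDiffWithinAt) one_ne_zero
    (convex_closedBall _ _) (isCompact_closedBall _ _)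
  set h : E → E := fun x => sphereDisplacement g (radialRetraction x)
  have hlip : LipschitzWith (C * 2) h := by
    have := hC.comp (lipschitzWith_radialRetraction.lipschitzOnWith (s := univ))
      (fun x _ => radialRetraction_mem x)
    exact lipschitzOnWith_univ.1 this
  have h0 : ∀ x, x ∉ Metric.ball (0 : E) 1 → h x = 0 := by
    intro x hx
    rw [mem_ball_zero_iff, not_lt] at hx
    exact sphereDisplacement_of_norm_eq_one (norm_radialRetraction_of_le hx) (hg1 _)
  have heq : ∀ x ∈ Metric.ball (0 : E) 1, h =ᶠ[nhds x] sphereDisplacement g := by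
    intro x hx
    filter_upwards [Metric.isOpen_ball.mem_nhds hx] with y hy
    simp only [h]
    rw [radialRetraction_of_norm_le (mem_ball_zero_iff.1 hy).le]
  have hd : ∀ x ∈ Metric.ball (0 : E) 1, DifferentiableAt ℝ h x := by
    intro x hx
    exact ((hk x (mem_ball_zero_iff.1 hx).le).differentiableAt one_ne_zero).congr_of_eventuallyEq
      (heq x hx)
  have hzero : ∀ x ∈ Metric.ball (0 : E) 1, (1 + fderiv ℝ h x : E →L[ℝ] E).det = 0 := by
    intro x hx
    refine det_fderiv_eq_zero_of_norm_eq_one (F := fun y => y + h y) (x := x)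
      ((hasFDerivAt_id x).add (hd x hx).hasFDerivAt) ?_
    filter_upwards [heq x hx, Metric.isOpen_ball.mem_nhds hx] with y hy hy1
    rw [hy]
    exact norm_add_sphereDisplacement (mem_ball_zero_iff.1 hy1).le (hne y)
  have hint := integral_det_one_add_fderiv hlip h0 hd (Measure.addHaar : Measure E)
  rw [setIntegral_congr_fun measurableSet_ball hzero, integral_zero] at hint
  have hpos : 0 < (Measure.addHaar : Measure E).real (Metric.ball 0 1) :=
    ENNReal.toReal_pos (Metric.measure_ball_pos _ _ one_pos).ne' measure_ball_lt_top.ne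
  linarith

/-- **Brouwer's fixed point theorem**, for self-maps of a Euclidean space with values in the closed
unit ball. -/
theorem exists_fixedPoint_of_continuous_of_norm_le_one {f : E → E} (hf : Continuous f)
    (hf1 : ∀ x, ‖f x‖ ≤ 1) : ∃ x, f x = x := by
  by_contra! hne
  obtain ⟨x₀, -, hx₀⟩ := (isCompact_closedBall (0 : E) 1).exists_isMinOn
    ⟨0, by simp⟩ (f := fun x => ‖f x - x‖) (hf.sub continuous_id).norm.continuousOn
  set ε := ‖f x₀ - x₀‖
  have hε : 0 < ε := norm_pos_iff.2 (sub_ne_zero.2 (hne x₀))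
  set δ := ε / 4
  have hδ : 0 < δ := by positivity
  obtain ⟨g, hg, hgf, -⟩ := hf.exists_contDiff_approx 1 (ε := fun _ => δ) continuous_const
    fun _ => hδ
  have hgn : ∀ x, ‖g x‖ < 1 + δ := by
    intro x
    have h1 := hgf x
    rw [dist_eq_norm] at h1
    have h2 := norm_le_norm_add_norm_sub' (g x) (f x)
    linarith [hf1 x]
  have hδ1 : 0 < 1 + δ := by positivity
  obtain ⟨x, hx⟩ := exists_fixedPoint_of_contDiff (g := fun x => (1 + δ)⁻¹ • g x)
    (contDiff_const.smul hg) (fun x => by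
      rw [norm_smul, norm_inv, Real.norm_of_nonneg hδ1.le, inv_mul_lt_one₀ hδ1]
      exact hgn x)
  have hgx : g x = (1 + δ) • x := (inv_smul_eq_iff₀ hδ1.ne').1 hx
  have hxn : ‖x‖ < 1 := by
    have := hgn x
    rw [hgx, norm_smul, Real.norm_of_nonneg hδ1.le] at this
    nlinarith
  have h1 : ε ≤ ‖f x - x‖ := hx₀ (mem_closedBall_zero_iff.2 hxn.le)
  have h2 : ‖f x - x‖ ≤ ‖g x - f x‖ + ‖g x - x‖ := by
    rw [norm_sub_rev (g x)]
    exact norm_sub_le_norm_sub_add_norm_sub _ _ _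
  have h3 := hgf x
  rw [dist_eq_norm] at h3
  have h4 : ‖g x - x‖ ≤ δ := by
    rw [hgx, add_smul, one_smul, add_sub_cancel_left, norm_smul, Real.norm_of_nonneg hδ.le]
    nlinarith
  have : δ = ε / 4 := rfl
  linarith

end Brouwer

section Schauder

/-- Continuous barycentric weights on `ι → ℝ`, extending the identity of the standard simplex. -/
noncomputable def simplexWeight {ι : Type*} [Fintype ι] (l : ι → ℝ) (i : ι) : ℝ :=
  max (l i) 0 / max (∑ j, max (l j) 0) 1
    + (1 - (∑ j, max (l j) 0) / max (∑ j, max (l j) 0) 1) / Fintype.card ι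

lemma simplexWeight_mem {ι : Type*} [Fintype ι] [Nonempty ι] (l : ι → ℝ) :
    simplexWeight l ∈ stdSimplex ℝ ι := by
  set s := ∑ j, max (l j) 0 with hs
  have hM : 0 < max s 1 := lt_of_lt_of_le one_pos (le_max_right _ _)
  refine ⟨fun i => ?_, ?_⟩
  · have : 0 ≤ 1 - s / max s 1 := by
      rw [sub_nonneg, div_le_one hM]
      exact le_max_left _ _
    unfold simplexWeight
    rw [← hs]
    positivity
  · unfold simplexWeight
    rw [← hs, Finset.sum_add_distrib, ← Finset.sum_div, ← hs, Finset.sum_const, Finset.card_univ,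
      nsmul_eq_mul, mul_div_cancel₀ _ (by positivity)]
    ring

lemma simplexWeight_of_mem {ι : Type*} [Fintype ι] {l : ι → ℝ} (hl : l ∈ stdSimplex ℝ ι) :
    simplexWeight l = l := by
  ext i
  have hsum : ∑ j, max (l j) 0 = 1 := by
    rw [← hl.2]
    exact Finset.sum_congr rfl fun j _ => max_eq_left (hl.1 j)
  simp [simplexWeight, hsum, hl.1 i]

lemma continuous_simplexWeight {ι : Type*} [Fintype ι] :
    Continuous (simplexWeight : (ι → ℝ) → ι → ℝ) := by
  unfold simplexWeight
  have : ∀ l : ι → ℝ, max (∑ j, max (l j) 0) 1 ≠ 0 := fun l =>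
    (lt_of_lt_of_le one_pos (le_max_right _ _)).ne'
  fun_prop (disch := exact this _)

variable {X : Type*} [NormedAddCommGroup X] [NormedSpace ℝ X]

lemma exists_norm_map_sub_le_of_isCompact_convex {K : Set X} (hK : IsCompact K)
    (hconv : Convex ℝ K) (hne : K.Nonempty) {T : X → X} (hT : ContinuousOn T K)
    (hmaps : MapsTo T K K) {ε : ℝ} (hε : 0 < ε) : ∃ x ∈ K, ‖T x - x‖ ≤ ε := by
  obtain ⟨t, htK, htfin, hcov⟩ := hK.finite_cover_balls hε
  have : Fintype t := htfin.fintype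
  have hcov' : ∀ y ∈ K, ∃ i : t, ‖y - i‖ < ε := by
    intro y hy
    obtain ⟨i, hi, hyi⟩ := mem_iUnion₂.1 (hcov hy)
    exact ⟨⟨i, hi⟩, by simpa [dist_eq_norm] using hyi⟩
  have : Nonempty t := by
    obtain ⟨y, hy⟩ := hne
    exact ⟨(hcov' y hy).choose⟩
  set w : X → t → ℝ := fun y i => max 0 (ε - ‖y - i‖)
  have hw0 : ∀ y i, 0 ≤ w y i := fun y i => le_max_left _ _
  have hW : ∀ y ∈ K, 0 < ∑ i, w y i := by
    intro y hy
    obtain ⟨i, hi⟩ := hcov' y hy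
    exact Finset.sum_pos' (fun i _ => hw0 y i)
      ⟨i, Finset.mem_univ _, lt_max_of_lt_right (sub_pos.2 hi)⟩
  set p : X → t → ℝ := fun y i => w y i / ∑ j, w y j
  have hp : ∀ y ∈ K, p y ∈ stdSimplex ℝ t := fun y hy =>
    ⟨fun i => div_nonneg (hw0 y i) (hW y hy).le, by
      simp only [p]
      rw [← Finset.sum_div, div_self (hW y hy).ne']⟩
  have hpc : ContinuousOn p K := by
    refine continuousOn_pi.2 fun i => ContinuousOn.div ?_ ?_ fun y hy => (hW y hy).ne'
    · simp only [w]; fun_prop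
    · simp only [w]; fun_prop
  set σ : (t → ℝ) → X := fun l => ∑ i, simplexWeight l i • (i : X)
  have hσK : ∀ l, σ l ∈ K := fun l =>
    hconv.sum_mem (fun i _ => (simplexWeight_mem l).1 i) (simplexWeight_mem l).2
      fun i _ => htK i.2
  have hσc : Continuous σ := continuous_finsetSum _ fun i _ =>
    ((continuous_apply i).comp continuous_simplexWeight).smul continuous_const
  set F : EuclideanSpace ℝ t → EuclideanSpace ℝ t :=
    fun l => WithLp.toLp 2 (p (T (σ (WithLp.ofLp l))))
  have hFc : Continuous F := by
    have h1 : Continuous fun l : EuclideanSpace ℝ t => σ (WithLp.ofLp l) :=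
      hσc.comp (PiLp.continuous_ofLp 2 _)
    have h2 := hT.comp_continuous h1 fun l => hσK _
    exact (PiLp.continuous_toLp 2 _).comp (hpc.comp_continuous h2 fun l => hmaps (hσK _))
  have hF1 : ∀ l, ‖F l‖ ≤ 1 := by
    intro l
    have hmem := hp _ (hmaps (hσK (WithLp.ofLp l)))
    rw [EuclideanSpace.norm_eq, Real.sqrt_le_one, ← hmem.2]
    refine Finset.sum_le_sum fun i _ => ?_
    have h0 := hmem.1 i
    have h1 := Finset.single_le_sum (fun j _ => hmem.1 j) (Finset.mem_univ i)
    rw [hmem.2] at h1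
    simp only [F, Real.norm_eq_abs, sq_abs]
    nlinarith
  obtain ⟨l, hl⟩ := exists_fixedPoint_of_continuous_of_norm_le_one hFc hF1
  set x := σ (WithLp.ofLp l)
  have hTx : T x ∈ K := hmaps (hσK _)
  have hmem := hp _ hTx
  have hlp : WithLp.ofLp l = p (T x) := (congrArg WithLp.ofLp hl).symm
  have hx : x = ∑ i : t, p (T x) i • (i : X) := by
    calc x = ∑ i : t, simplexWeight (WithLp.ofLp l) i • (i : X) := rfl
      _ = _ := by rw [hlp, simplexWeight_of_mem hmem]
  refine ⟨x, hσK _, ?_⟩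
  have hdiff : T x - x = ∑ i : t, p (T x) i • (T x - i) := by
    simp_rw [smul_sub]
    rw [Finset.sum_sub_distrib, ← Finset.sum_smul, hmem.2, one_smul, ← hx]
  rw [hdiff]
  refine (norm_sum_le _ _).trans ?_
  calc ∑ i : t, ‖p (T x) i • (T x - i)‖ ≤ ∑ i : t, p (T x) i * ε := by
        refine Finset.sum_le_sum fun i _ => ?_
        rw [norm_smul, Real.norm_of_nonneg (hmem.1 i)]
        by_cases hi : ‖T x - i‖ ≤ ε
        · exact mul_le_mul_of_nonneg_left hi (hmem.1 i)
        · have : p (T x) i = 0 := by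
            simp only [p, w]
            rw [max_eq_left (by linarith), zero_div]
          simp [this]
    _ = ε := by rw [← Finset.sum_mul, hmem.2, one_mul]

/-- **Schauder's fixed point theorem** for compact convex sets in a normed space. -/
theorem exists_fixedPoint_of_isCompact_convex {K : Set X} (hK : IsCompact K)
    (hconv : Convex ℝ K) (hne : K.Nonempty) {T : X → X} (hT : ContinuousOn T K)
    (hmaps : MapsTo T K K) : ∃ x ∈ K, T x = x := by
  obtain ⟨x, hxK, hx⟩ := hK.exists_isMinOn hne (f := fun x => ‖T x - x‖)
    (hT.sub continuousOn_id).norm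
  refine ⟨x, hxK, sub_eq_zero.1 (norm_le_zero_iff.1 (le_of_forall_pos_le_add fun ε hε => ?_))⟩
  obtain ⟨y, hyK, hy⟩ := exists_norm_map_sub_le_of_isCompact_convex hK hconv hne hT hmaps hε
  rw [zero_add]
  exact (hx hyK).trans hy

end Schauder

/-- A parametrised contraction principle for operators on bounded functions: the fixed points
depend on the parameter in a controlled way and stay in every invariant ball. -/
theorem exists_bounded_fixedPoint_family {J E W : Type*} [NormedAddCommGroup E] [CompleteSpace E]
    (F : W → (J → E) → J → E) (d : W → W → ℝ) {κ : ℝ} (hκ0 : 0 ≤ κ) (hκ1 : κ < 1)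
    (hd : ∀ w, d w w = 0)
    (hF : ∀ w w' y y' C, 0 ≤ C → (∀ t, ‖y t - y' t‖ ≤ C) →
      ∀ t, ‖F w y t - F w' y' t‖ ≤ κ * C + d w w')
    (hF0 : ∀ w, ∃ B, ∀ t, ‖F w 0 t‖ ≤ B) :
    ∃ S : W → J → E, (∀ w, F w (S w) = S w) ∧ (∀ w, ∃ B, ∀ t, ‖S w t‖ ≤ B) ∧
      (∀ w w' t, ‖S w t - S w' t‖ ≤ d w w' / (1 - κ)) ∧
      ∀ w (b : J → E) (ρ B : ℝ), (∀ t, ‖b t‖ ≤ B) → 0 ≤ ρ →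
        (∀ y, (∀ t, ‖y t - b t‖ ≤ ρ) → ∀ t, ‖F w y t - b t‖ ≤ ρ) →
        ∀ t, ‖S w t - b t‖ ≤ ρ := by
  let V := lp (fun _ : J => E) ⊤
  have mk : ∀ (y : J → E) (B : ℝ), (∀ t, ‖y t‖ ≤ B) → Memℓp (E := fun _ : J => E) y ⊤ :=
    fun y B hB => memℓp_infty ⟨B, by rintro _ ⟨t, rfl⟩; exact hB t⟩
  have hmem : ∀ w (y : V), Memℓp (E := fun _ : J => E) (F w y) ⊤ := by
    intro w y
    obtain ⟨B, hB⟩ := hF0 w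
    refine mk _ (κ * ‖y‖ + B) fun t => ?_
    have h := hF w w y 0 ‖y‖ (norm_nonneg _)
      (fun t => by simpa using lp.norm_apply_le_norm ENNReal.top_ne_zero y t) t
    rw [hd, add_zero] at h
    calc ‖F w y t‖ = ‖(F w y t - F w 0 t) + F w 0 t‖ := by rw [sub_add_cancel]
      _ ≤ _ := (norm_add_le _ _).trans (add_le_add h (hB t))
  let T : W → V → V := fun w y => ⟨F w y, hmem w y⟩
  have hT : ∀ w, ContractingWith κ.toNNReal (T w) := by
    refine fun w => ⟨by rw [← NNReal.coe_lt_coe, Real.coe_toNNReal _ hκ0]; exact hκ1,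
      LipschitzWith.of_dist_le_mul fun y y' => ?_⟩
    rw [dist_eq_norm, dist_eq_norm, Real.coe_toNNReal _ hκ0]
    refine lp.norm_le_of_forall_le (by positivity) fun t => ?_
    have h := hF w w y y' ‖y - y'‖ (norm_nonneg _)
      (fun t => lp.norm_apply_le_norm ENNReal.top_ne_zero (y - y') t) t
    rw [hd, add_zero] at h
    exact h
  let S : W → V := fun w => ContractingWith.fixedPoint (T w) (hT w)
  have hS : ∀ w, F w (S w) = S w := fun w =>
    congrArg (fun y : V => (y : J → E)) (hT w).fixedPoint_isFixedPt
  refine ⟨fun w => S w, hS, fun w => ⟨‖S w‖, lp.norm_apply_le_norm ENNReal.top_ne_zero (S w)⟩,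
    fun w w' t => ?_, fun w b ρ B hB hρ hinv t => ?_⟩
  · have h1 : ∀ t, ‖S w t - S w' t‖ ≤ ‖S w - S w'‖ :=
      lp.norm_apply_le_norm ENNReal.top_ne_zero (S w - S w')
    have h2 : ∀ t, ‖S w t - S w' t‖ ≤ κ * ‖S w - S w'‖ + d w w' := fun t => by
      have h := hF w w' (S w) (S w') _ (norm_nonneg _) h1 t
      rwa [hS, hS] at h
    have h3 : ‖S w - S w'‖ ≤ κ * ‖S w - S w'‖ + d w w' :=
      lp.norm_le_of_forall_le ((norm_nonneg _).trans (h2 t)) h2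
    refine (h1 t).trans ?_
    rw [le_div_iff₀ (by linarith)]
    linarith
  · let b' : V := ⟨b, mk b B hB⟩
    have hmaps : ∀ y : V, y ∈ Metric.closedBall b' ρ → T w y ∈ Metric.closedBall b' ρ := by
      intro y hy
      rw [mem_closedBall_iff_norm] at hy ⊢
      refine lp.norm_le_of_forall_le hρ fun t => hinv y (fun t => ?_) t
      exact (lp.norm_apply_le_norm ENNReal.top_ne_zero (y - b') t).trans hy
    have hit : ∀ k, (T w)^[k] b' ∈ Metric.closedBall b' ρ := by
      intro k
      induction k with
      | zero => simpa using hρ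
      | succ k ih => rw [Function.iterate_succ_apply']; exact hmaps _ ih
    have hlim : S w ∈ Metric.closedBall b' ρ :=
      Metric.isClosed_closedBall.mem_of_tendsto ((hT w).tendsto_iterate_fixedPoint b')
        (Eventually.of_forall hit)
    rw [mem_closedBall_iff_norm] at hlim
    exact (lp.norm_apply_le_norm ENNReal.top_ne_zero (S w - b') t).trans hlim

/-- The paths on a compact interval whose increments are controlled by an invertible continuous
family of operators form a compact convex set. -/
theorem isCompact_convex_setOf_norm_increment_le {E : Type*} [NormedAddCommGroup E]
    [NormedSpace ℝ E] [FiniteDimensional ℝ E] {τ : ℝ} (hτ : 0 ≤ τ) {P Q : ℝ → E →L[ℝ] E}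
    {BQ : ℝ} (hBQ : ∀ t ∈ Icc 0 τ, ‖Q t‖ ≤ BQ) (hQP : ∀ t x, Q t (P t x) = x)
    {D : ℝ} (hD : 0 ≤ D) :
    IsCompact {w : BoundedContinuousFunction (Icc 0 τ) E | w ⟨0, left_mem_Icc.2 hτ⟩ = 0 ∧
      ∀ s t : Icc 0 τ, s ≤ t → ‖P t (w t - w s)‖ ≤ D * (t - s)} ∧
    Convex ℝ {w : BoundedContinuousFunction (Icc 0 τ) E | w ⟨0, left_mem_Icc.2 hτ⟩ = 0 ∧
      ∀ s t : Icc 0 τ, s ≤ t → ‖P t (w t - w s)‖ ≤ D * (t - s)} := by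
  have : ProperSpace E := FiniteDimensional.proper ℝ E
  have hBQ0 : 0 ≤ BQ := (norm_nonneg _).trans (hBQ 0 (left_mem_Icc.2 hτ))
  have hev : ∀ t : Icc 0 τ, Continuous fun w : BoundedContinuousFunction (Icc 0 τ) E => w t :=
    fun t => continuous_eval_const t
  have hinc : ∀ w : BoundedContinuousFunction (Icc 0 τ) E,
      (∀ s t : Icc 0 τ, s ≤ t → ‖P t (w t - w s)‖ ≤ D * (t - s)) →
      ∀ s t : Icc 0 τ, s ≤ t → ‖w t - w s‖ ≤ BQ * D * (t - s) := by
    intro w hw s t hst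
    calc ‖w t - w s‖ = ‖Q t (P t (w t - w s))‖ := by rw [hQP]
      _ ≤ ‖Q t‖ * ‖P t (w t - w s)‖ := (Q t).le_opNorm _
      _ ≤ BQ * (D * (t - s)) :=
        mul_le_mul (hBQ t t.2) (hw s t hst) (norm_nonneg _) hBQ0
      _ = _ := by ring
  constructor
  · refine BoundedContinuousFunction.arzela_ascoli₂ (Metric.closedBall 0 (BQ * D * τ))
      (isCompact_closedBall _ _) _ ?_ ?_ ?_
    · refine IsClosed.inter (isClosed_eq (hev _) continuous_const) ?_
      have hset : {w : BoundedContinuousFunction (Icc 0 τ) E |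
          ∀ s t : Icc 0 τ, s ≤ t → ‖P t (w t - w s)‖ ≤ D * (t - s)} =
          ⋂ (s : Icc 0 τ) (t : Icc 0 τ) (_ : s ≤ t),
            {w | ‖P t (w t - w s)‖ ≤ D * (t - s)} := by
        ext w
        simp only [mem_iInter]
        rfl
      suffices h : IsClosed {w : BoundedContinuousFunction (Icc 0 τ) E |
          ∀ s t : Icc 0 τ, s ≤ t → ‖P t (w t - w s)‖ ≤ D * (t - s)} from h
      rw [hset]
      exact isClosed_iInter fun s => isClosed_iInter fun t => isClosed_iInter fun _ =>
        isClosed_le ((P t).continuous.comp ((hev t).sub (hev s))).norm continuous_const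
    · intro w t hw
      have h := hinc w hw.2 ⟨0, left_mem_Icc.2 hτ⟩ t t.2.1
      rw [hw.1, sub_zero] at h
      rw [mem_closedBall_zero_iff]
      refine h.trans ?_
      have := t.2.2
      simp only [sub_zero]
      gcongr
    · refine (Metric.equicontinuous_of_continuity_modulus (fun x => BQ * D * x) ?_ _ ?_)
      · have : Continuous fun x : ℝ => BQ * D * x := by fun_prop
        simpa using this.tendsto 0
      · rintro s t ⟨w, hw⟩
        rcases le_total s t with h | h
        · rw [dist_comm, dist_eq_norm, dist_comm, Subtype.dist_eq, Real.dist_eq,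
            abs_of_nonneg (sub_nonneg.2 (Subtype.coe_le_coe.2 h))]
          exact hinc w hw.2 s t h
        · rw [dist_eq_norm, Subtype.dist_eq, Real.dist_eq,
            abs_of_nonneg (sub_nonneg.2 (Subtype.coe_le_coe.2 h))]
          exact hinc w hw.2 t s h
  · intro w hw w' hw' a b ha hb hab
    refine ⟨by simp [hw.1, hw'.1], fun s t hst => ?_⟩
    have h1 : ‖P t (w t - w s)‖ ≤ D * (t.1 - s.1) := hw.2 s t hst
    have h2 : ‖P t (w' t - w' s)‖ ≤ D * (t.1 - s.1) := hw'.2 s t hst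
    calc ‖P t ((a • w + b • w') t - (a • w + b • w') s)‖
        = ‖a • P t (w t - w s) + b • P t (w' t - w' s)‖ := by
          rw [← map_smul, ← map_smul, ← map_add]
          congr 2
          simp only [BoundedContinuousFunction.add_apply, BoundedContinuousFunction.smul_apply]
          module
      _ ≤ a * (D * (t.1 - s.1)) + b * (D * (t.1 - s.1)) := by
          refine (norm_add_le _ _).trans ?_
          rw [norm_smul, norm_smul, Real.norm_of_nonneg ha, Real.norm_of_nonneg hb]
          exact add_le_add (mul_le_mul_of_nonneg_left h1 ha) (mul_le_mul_of_nonneg_left h2 hb)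
      _ = D * (t.1 - s.1) := by rw [← add_mul, hab, one_mul]

theorem IntervalIntegrable.clm_apply_of_continuous {E : Type*} [NormedAddCommGroup E]
    [NormedSpace ℝ E] {Q : ℝ → E →L[ℝ] E} (hQ : Continuous Q) {k : ℝ → E} {a b : ℝ}
    (hk : IntervalIntegrable k volume a b) :
    IntervalIntegrable (fun v => Q v (k v)) volume a b := by
  obtain ⟨B, hB⟩ := (isCompact_uIcc (a := a) (b := b)).exists_bound_of_continuousOn hQ.continuousOn
  rw [intervalIntegrable_iff] at hk ⊢
  refine Integrable.mono' (hk.norm.const_mul B) ?_ ?_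
  · exact (ContinuousLinearMap.id ℝ (E →L[ℝ] E)).aestronglyMeasurable_comp₂
      hQ.aestronglyMeasurable hk.aestronglyMeasurable
  · refine (ae_restrict_iff' measurableSet_uIoc).2 (Eventually.of_forall fun v hv => ?_)
    exact ((Q v).le_opNorm _).trans
      (mul_le_mul_of_nonneg_right (hB v (uIoc_subset_uIcc hv)) (norm_nonneg _))

/-- Existence for an integral system that is posed on finitely many disjoint segments
`(a i, b i]` of `[0, τ]`, has a contractive history and contractive initial values, and leaves
a ball of bounded functions invariant. -/
theorem exists_segmentwise_mild_solution {E : Type*} [NormedAddCommGroup E] [NormedSpace ℝ E]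
    [FiniteDimensional ℝ E] {r τ : ℝ} (hτ : 0 < τ) {P Q : ℝ → E →L[ℝ] E}
    (hP : Continuous P) (hQ : Continuous Q) (hPQ : ∀ t x, P t (Q t x) = x)
    (hQP : ∀ t x, Q t (P t x) = x) {M : ℝ} (hM0 : 0 ≤ M)
    (hM : ∀ t s, 0 ≤ s → s ≤ t → t ≤ τ → ∀ x, ‖P t (Q s x)‖ ≤ M * ‖x‖)
    {N : ℕ} {a b : ℕ → ℝ} (ha : ∀ i ≤ N, 0 ≤ a i) (hb : ∀ i ≤ N, b i ≤ τ)
    (hdisj : ∀ i ≤ N, ∀ j ≤ N, ∀ t, t ∈ Ioc (a i) (b i) → t ∈ Ioc (a j) (b j) → i = j)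
    (h : (ℝ → E) → ℝ → E) (c : ℕ → (ℝ → E) → E) {κ : ℝ} (hκ0 : 0 ≤ κ) (hκ1 : κ < 1)
    (hh : ∀ y y' C, 0 ≤ C → (∀ t, ‖y t - y' t‖ ≤ C) →
      ∀ u ∈ Icc (-r) 0, ‖h y u - h y' u‖ ≤ κ * C)
    (hc : ∀ i ≤ N, ∀ y y' C, 0 ≤ C → (∀ t, ‖y t - y' t‖ ≤ C) → M * ‖c i y - c i y'‖ ≤ κ * C)
    (hh0 : ∃ B, ∀ u ∈ Icc (-r) 0, ‖h 0 u‖ ≤ B)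
    (p : ℝ → E) {ρ R D : ℝ} (hρ : 0 ≤ ρ) (hp : ∀ t, ‖p t‖ + ρ ≤ R) (hD : 0 ≤ D)
    (hinvh : ∀ y, (∀ t, ‖y t - p t‖ ≤ ρ) → ∀ u ∈ Icc (-r) 0, ‖h y u - p u‖ ≤ ρ)
    (hinvc : ∀ y, (∀ t, ‖y t - p t‖ ≤ ρ) → ∀ i ≤ N, ∀ t ∈ Ioc (a i) (b i),
      ‖P t (Q (a i) (c i y)) - p t‖ + M * D * τ ≤ ρ)
    (hinvp : ∀ t ∉ Icc (-r) 0, (∀ i ≤ N, t ∉ Ioc (a i) (b i)) → ‖p t‖ ≤ ρ)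
    (k : (ℝ → E) → ℝ → E)
    (hkint : ∀ y, (∃ B, ∀ t, ‖y t‖ ≤ B) → IntervalIntegrable (k y) volume 0 τ)
    (hkbd : ∀ y, (∀ t, ‖y t‖ ≤ R) → ∀ v ∈ Icc 0 τ, ‖k y v‖ ≤ D)
    {Λ : ℝ} (hΛ : 0 ≤ Λ)
    (hklip : ∀ y y', (∀ t, ‖y t‖ ≤ R) → (∀ t, ‖y' t‖ ≤ R) → ∀ C, 0 ≤ C →
      (∀ t, ‖y t - y' t‖ ≤ C) → ∀ v ∈ Icc 0 τ, ‖k y v - k y' v‖ ≤ Λ * C) :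
    ∃ (z : ℝ → E) (ζ : ℕ → ℝ → E), (∀ t, ‖z t - p t‖ ≤ ρ) ∧ (∀ u ∈ Icc (-r) 0, z u = h z u) ∧
      (∀ i ≤ N, Continuous (ζ i) ∧ ζ i (a i) = c i z ∧ ∀ t ∈ Ioc (a i) (b i), z t = ζ i t ∧
        z t = P t (Q (a i) (c i z)) + ∫ v in (a i)..t, P t (Q v (k z v))) ∧
      ∀ t ∉ Icc (-r) 0, (∀ i ≤ N, t ∉ Ioc (a i) (b i)) → z t = 0 := by
  classical
  obtain ⟨BP, hBP⟩ := (isCompact_Icc (a := 0) (b := τ)).exists_bound_of_continuousOn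
    hP.continuousOn
  obtain ⟨BQ, hBQ⟩ := (isCompact_Icc (a := 0) (b := τ)).exists_bound_of_continuousOn
    hQ.continuousOn
  have h0τ : (0 : ℝ) ∈ Icc 0 τ := left_mem_Icc.2 hτ.le
  have hBP0 : 0 ≤ BP := (norm_nonneg _).trans (hBP 0 h0τ)
  have hBQ0 : 0 ≤ BQ := (norm_nonneg _).trans (hBQ 0 h0τ)
  have hseg : ∀ i ≤ N, ∀ t ∈ Ioc (a i) (b i), a i ∈ Icc 0 τ ∧ t ∈ Icc 0 τ := fun i hi t ht =>
    ⟨⟨ha i hi, (ht.1.le.trans ht.2).trans (hb i hi)⟩, (ha i hi).trans ht.1.le, ht.2.trans (hb i hi)⟩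
  let e : BoundedContinuousFunction (Icc 0 τ) E → ℝ → E := fun w t => w (projIcc 0 τ hτ.le t)
  have he : ∀ w w' t, ‖e w t - e w' t‖ ≤ ‖w - w'‖ := fun w w' t => (w - w').norm_coe_le_norm _
  have hec : ∀ w, Continuous (e w) := fun w => w.continuous.comp continuous_projIcc
  let F : BoundedContinuousFunction (Icc 0 τ) E → (ℝ → E) → ℝ → E := fun w y t =>
    if t ∈ Icc (-r) 0 then h y t
    else if H : ∃ i, i ≤ N ∧ t ∈ Ioc (a i) (b i) then
      P t (Q (a H.choose) (c H.choose y) + (e w t - e w (a H.choose)))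
    else 0
  have hFh : ∀ w y, ∀ t ∈ Icc (-r) 0, F w y t = h y t := fun w y t ht => if_pos ht
  have hFc : ∀ w y, ∀ i ≤ N, ∀ t ∈ Ioc (a i) (b i),
      F w y t = P t (Q (a i) (c i y) + (e w t - e w (a i))) := by
    intro w y i hi t ht
    have H : ∃ i, i ≤ N ∧ t ∈ Ioc (a i) (b i) := ⟨i, hi, ht⟩
    have hch : H.choose = i := hdisj _ H.choose_spec.1 _ hi t H.choose_spec.2 ht
    have ht0 : t ∉ Icc (-r) 0 := fun h' => absurd ((ha i hi).trans_lt ht.1) (not_lt.2 h'.2)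
    simp only [F]
    rw [if_neg ht0, dif_pos H, hch]
  have hFo : ∀ w y, ∀ t ∉ Icc (-r) 0, (∀ i ≤ N, t ∉ Ioc (a i) (b i)) → F w y t = 0 := by
    intro w y t ht hti
    simp only [F]
    rw [if_neg ht, dif_neg]
    rintro ⟨i, hi, hti'⟩
    exact hti i hi hti'
  have hcases : ∀ t, t ∈ Icc (-r) 0 ∨ (∃ i ≤ N, t ∈ Ioc (a i) (b i)) ∨
      (t ∉ Icc (-r) 0 ∧ ∀ i ≤ N, t ∉ Ioc (a i) (b i)) := by
    intro t
    by_cases h1 : t ∈ Icc (-r) 0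
    · exact .inl h1
    by_cases h2 : ∃ i ≤ N, t ∈ Ioc (a i) (b i)
    · exact .inr (.inl h2)
    · push Not at h2
      exact .inr (.inr ⟨h1, h2⟩)
  obtain ⟨S, hSfix, hSbd, hSlip, hSball⟩ := exists_bounded_fixedPoint_family F
    (fun w w' => 2 * BP * ‖w - w'‖) hκ0 hκ1 (by simp) (by
      intro w w' y y' C hC hy t
      have hd : 0 ≤ 2 * BP * ‖w - w'‖ := by positivity
      rcases hcases t with ht | ⟨i, hi, ht⟩ | ⟨ht, hti⟩
      · rw [hFh _ _ t ht, hFh _ _ t ht]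
        exact (hh y y' C hC hy t ht).trans (by linarith)
      · rw [hFc _ _ i hi t ht, hFc _ _ i hi t ht]
        obtain ⟨hai, htτ⟩ := hseg i hi t ht
        have h1 := (hM t (a i) hai.1 ht.1.le htτ.2 (c i y - c i y')).trans (hc i hi y y' C hC hy)
        have h2 : ‖P t ((e w t - e w' t) - (e w (a i) - e w' (a i)))‖ ≤ 2 * BP * ‖w - w'‖ :=
          calc _ ≤ BP * (‖w - w'‖ + ‖w - w'‖) := ((P t).le_opNorm _).trans
                (mul_le_mul (hBP t htτ) ((norm_sub_le _ _).trans
                  (add_le_add (he w w' t) (he w w' (a i)))) (norm_nonneg _) hBP0)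
            _ = _ := by ring
        refine le_trans (le_of_eq ?_) ((norm_add_le _ _).trans (add_le_add h1 h2))
        rw [← map_sub, ← map_add, map_sub (Q (a i))]
        congr 2
        abel
      · rw [hFo _ _ t ht hti, hFo _ _ t ht hti, sub_zero, norm_zero]
        positivity) (by
      intro w
      obtain ⟨B, hB⟩ := hh0
      refine ⟨|B| + (∑ i ∈ Finset.range (N + 1), M * ‖c i 0‖ + 2 * BP * ‖w‖), fun t => ?_⟩
      have hs : 0 ≤ ∑ i ∈ Finset.range (N + 1), M * ‖c i 0‖ :=
        Finset.sum_nonneg fun i _ => by positivity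
      have hd : 0 ≤ 2 * BP * ‖w‖ := by positivity
      rcases hcases t with ht | ⟨i, hi, ht⟩ | ⟨ht, hti⟩
      · rw [hFh _ _ t ht]
        exact ((hB t ht).trans (le_abs_self B)).trans (by linarith)
      · rw [hFc _ _ i hi t ht, map_add]
        obtain ⟨hai, htτ⟩ := hseg i hi t ht
        have h1 := (hM t (a i) hai.1 ht.1.le htτ.2 (c i 0)).trans
          (Finset.single_le_sum (f := fun i => M * ‖c i 0‖) (fun i _ => by positivity)
            (Finset.mem_range.2 (Nat.lt_succ_of_le hi)))
        have h2 : ‖P t (e w t - e w (a i))‖ ≤ 2 * BP * ‖w‖ :=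
          calc _ ≤ BP * (‖w‖ + ‖w‖) := ((P t).le_opNorm _).trans
                (mul_le_mul (hBP t htτ) ((norm_sub_le _ _).trans
                  (add_le_add (w.norm_coe_le_norm _) (w.norm_coe_le_norm _)))
                  (norm_nonneg _) hBP0)
            _ = _ := by ring
        refine ((norm_add_le _ _).trans (add_le_add h1 h2)).trans ?_
        linarith [abs_nonneg B]
      · rw [hFo _ _ t ht hti, norm_zero]
        positivity)
  set 𝒦 : Set (BoundedContinuousFunction (Icc 0 τ) E) :=
    {w | w ⟨0, left_mem_Icc.2 hτ.le⟩ = 0 ∧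
      ∀ s t : Icc 0 τ, s ≤ t → ‖P t (w t - w s)‖ ≤ M * D * (t - s)} with h𝒦
  have hKcc := isCompact_convex_setOf_norm_increment_le hτ.le hBQ hQP (mul_nonneg hM0 hD)
  rw [← h𝒦] at hKcc
  have hpR : ∀ t, ‖p t‖ ≤ R - ρ := fun t => by linarith [hp t]
  have hball : ∀ w ∈ 𝒦, ∀ t, ‖S w t - p t‖ ≤ ρ := by
    intro w hw
    refine hSball w p ρ _ hpR hρ fun y hy t => ?_
    rcases hcases t with ht | ⟨i, hi, ht⟩ | ⟨ht, hti⟩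
    · rw [hFh _ _ t ht]
      exact hinvh y hy t ht
    · rw [hFc _ _ i hi t ht, map_add]
      obtain ⟨hai, htτ⟩ := hseg i hi t ht
      have h1 : ‖P t (e w t - e w (a i))‖ ≤ M * D * τ := by
        have h2 := hw.2 ⟨a i, hai⟩ ⟨t, htτ⟩ ht.1.le
        simp only [e, projIcc_of_mem hτ.le htτ, projIcc_of_mem hτ.le hai]
        exact h2.trans (mul_le_mul_of_nonneg_left (by linarith [hai.1, htτ.2])
          (mul_nonneg hM0 hD))
      refine le_trans ?_ (hinvc y hy i hi t ht)
      rw [add_sub_right_comm]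
      exact (norm_add_le _ _).trans (by linarith)
    · rw [hFo _ _ t ht hti, zero_sub, norm_neg]
      exact hinvp t ht hti
  have hSR : ∀ w ∈ 𝒦, ∀ t, ‖S w t‖ ≤ R := fun w hw t => by
    have h1 := norm_le_norm_add_norm_sub' (S w t) (p t)
    linarith [hball w hw t, hp t]
  have hint : ∀ w, IntervalIntegrable (fun v => Q v (k (S w) v)) volume 0 τ := fun w =>
    (hkint _ (hSbd w)).clm_apply_of_continuous hQ
  have hints : ∀ w, ∀ s ∈ Icc 0 τ, ∀ t ∈ Icc 0 τ,
      IntervalIntegrable (fun v => Q v (k (S w) v)) volume s t := fun w s hs t ht =>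
    (hint w).mono_set (uIcc_subset_uIcc (by rwa [uIcc_of_le hτ.le]) (by rwa [uIcc_of_le hτ.le]))
  have hprim : ∀ w, ContinuousOn (fun t => ∫ v in (0 : ℝ)..t, Q v (k (S w) v)) (Icc 0 τ) := by
    intro w
    have h1 := intervalIntegral.continuousOn_primitive_interval' (hint w) left_mem_uIcc
    rwa [uIcc_of_le hτ.le] at h1
  let T : BoundedContinuousFunction (Icc 0 τ) E → BoundedContinuousFunction (Icc 0 τ) E :=
    fun w => BoundedContinuousFunction.mkOfCompact
      ⟨fun t => ∫ v in (0 : ℝ)..t, Q v (k (S w) v), (hprim w).domRestrict⟩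
  have hTapp : ∀ w t, T w t = ∫ v in (0 : ℝ)..t, Q v (k (S w) v) := fun w t => rfl
  have hTsub : ∀ w (s t : Icc 0 τ), T w t - T w s = ∫ v in (s : ℝ)..t, Q v (k (S w) v) :=
    fun w s t => intervalIntegral.integral_interval_sub_left (hints w _ h0τ _ t.2)
      (hints w _ h0τ _ s.2)
  have hPint : ∀ w (s t : Icc 0 τ),
      P t (T w t - T w s) = ∫ v in (s : ℝ)..t, P t (Q v (k (S w) v)) := fun w s t => by
    rw [hTsub, ContinuousLinearMap.intervalIntegral_comp_comm _ (hints w _ s.2 _ t.2)]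
  have hTmaps : MapsTo T 𝒦 𝒦 := by
    refine fun w hw => ⟨by rw [hTapp, intervalIntegral.integral_same], fun s t hst => ?_⟩
    have hst' : (s : ℝ) ≤ t := hst
    rw [hPint, ← abs_of_nonneg (sub_nonneg.2 hst')]
    refine intervalIntegral.norm_integral_le_of_norm_le_const fun v hv => ?_
    rw [uIoc_of_le hst'] at hv
    have hv0 : 0 ≤ v := s.2.1.trans hv.1.le
    exact (hM t v hv0 hv.2 t.2.2 _).trans (mul_le_mul_of_nonneg_left
      (hkbd _ (hSR w hw) v ⟨hv0, hv.2.trans t.2.2⟩) hM0)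
  have hTlip : ∀ w ∈ 𝒦, ∀ w' ∈ 𝒦,
      ‖T w - T w'‖ ≤ BQ * (Λ * (2 * BP / (1 - κ))) * τ * ‖w - w'‖ := by
    intro w hw w' hw'
    have h1κ : 0 < 1 - κ := by linarith
    refine (BoundedContinuousFunction.norm_le (by positivity)).2 fun t => ?_
    have h1 : (T w - T w') t = ∫ v in (0 : ℝ)..t, (Q v (k (S w) v) - Q v (k (S w') v)) :=
      (intervalIntegral.integral_sub (hints w _ h0τ _ t.2) (hints w' _ h0τ _ t.2)).symm
    rw [h1]
    have h2 : ‖∫ v in (0 : ℝ)..t, (Q v (k (S w) v) - Q v (k (S w') v))‖ ≤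
        BQ * (Λ * (2 * BP * ‖w - w'‖ / (1 - κ))) * |(t : ℝ) - 0| := by
      refine intervalIntegral.norm_integral_le_of_norm_le_const fun v hv => ?_
      rw [uIoc_of_le t.2.1] at hv
      have hv' : v ∈ Icc 0 τ := ⟨hv.1.le, hv.2.trans t.2.2⟩
      rw [← map_sub]
      exact ((Q v).le_opNorm _).trans (mul_le_mul (hBQ v hv')
        (hklip _ _ (hSR w hw) (hSR w' hw') _ (by positivity) (hSlip w w') v hv')
        (norm_nonneg _) hBQ0)
    rw [sub_zero, abs_of_nonneg t.2.1] at h2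
    calc _ ≤ _ := h2
      _ ≤ BQ * (Λ * (2 * BP * ‖w - w'‖ / (1 - κ))) * τ :=
        mul_le_mul_of_nonneg_left t.2.2 (by positivity)
      _ = _ := by ring
  have hTcont : ContinuousOn T 𝒦 := by
    have h1κ : 0 < 1 - κ := by linarith
    refine LipschitzOnWith.continuousOn (K := (BQ * (Λ * (2 * BP / (1 - κ))) * τ).toNNReal)
      (LipschitzOnWith.of_dist_le_mul fun w hw w' hw' => ?_)
    rw [Real.coe_toNNReal _ (by positivity), dist_eq_norm, dist_eq_norm]
    exact hTlip w hw w' hw'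
  have hne : 𝒦.Nonempty := by
    refine ⟨0, rfl, fun s t hst => ?_⟩
    have hst' : (s : ℝ) ≤ t := hst
    simpa using mul_nonneg (mul_nonneg hM0 hD) (sub_nonneg.2 hst')
  obtain ⟨w, hw, hTw⟩ := exists_fixedPoint_of_isCompact_convex hKcc.1 hKcc.2 hne hTcont hTmaps
  refine ⟨S w, fun i t => P t (Q (a i) (c i (S w)) + (e w t - e w (a i))), hball w hw,
    fun u hu => ?_, fun i hi => ⟨?_, ?_, fun t ht => ?_⟩, fun t ht hti => ?_⟩
  · rw [← hFh w _ u hu, hSfix]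
  · have := hec w
    fun_prop
  · simp [hPQ]
  · obtain ⟨hai, htτ⟩ := hseg i hi t ht
    have h1 : S w t = P t (Q (a i) (c i (S w)) + (e w t - e w (a i))) := by
      rw [← hFc w _ i hi t ht, hSfix]
    refine ⟨h1, ?_⟩
    rw [h1, map_add]
    congr 1
    have h2 := hPint w ⟨a i, hai⟩ ⟨t, htτ⟩
    rw [hTw] at h2
    simp only [e, projIcc_of_mem hτ.le htτ, projIcc_of_mem hτ.le hai]
    exact h2
  · rw [← hFo w (S w) t ht hti, hSfix]

theorem exists_mem_Ioc_succ {a : ℕ → ℝ} {u : ℝ} {m : ℕ} (h0 : a 0 < u) (hm : u ≤ a m) :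
    ∃ i < m, u ∈ Ioc (a i) (a (i + 1)) := by
  induction m with
  | zero => exact absurd hm (not_le.2 h0)
  | succ m ih =>
    by_cases h : u ≤ a m
    · obtain ⟨i, hi, hu⟩ := ih h
      exact ⟨i, hi.trans m.lt_succ_self, hu⟩
    · exact ⟨m, m.lt_succ_self, not_le.1 h, hm⟩

theorem le_of_forall_le_succ {a : ℕ → ℝ} {N : ℕ} (ha : ∀ i ≤ N, a i ≤ a (i + 1)) {i j : ℕ}
    (hij : i ≤ j) (hj : j ≤ N + 1) : a i ≤ a j := by
  induction j, hij using Nat.le_induction with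
  | base => exact le_rfl
  | succ j _ ih => exact (ih (by omega)).trans (ha j (by omega))

/-- A function that vanishes on each `(t i, s i]` and follows a continuous path on each
`(s i, t (i + 1)]`, starting from `0` if `t i < s i`, is continuous off the points `t i`, where
it is left-continuous with right limits. -/
theorem continuousWithinAt_of_segmentwise {E : Type*} [NormedAddCommGroup E] {N : ℕ}
    {tt ss : ℕ → ℝ} (hts : ∀ i ≤ N, tt i ≤ ss i ∧ ss i < tt (i + 1)) (htt0 : tt 0 = 0)
    (hss0 : ss 0 = 0) {τ : ℝ} (hτ : tt (N + 1) = τ) {z : ℝ → E} {ζ : ℕ → ℝ → E}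
    (hζ : ∀ i ≤ N, Continuous (ζ i))
    (hz : ∀ i ≤ N, ∀ t ∈ Ioc (ss i) (tt (i + 1)), z t = ζ i t)
    (hz0 : ∀ i ≤ N, ∀ t ∈ Ioc (tt i) (ss i), z t = 0) (h0 : z 0 = ζ 0 0)
    (hζs : ∀ i ≤ N, tt i < ss i → ζ i (ss i) = 0) :
    (∀ u ∈ Icc (0 : ℝ) τ, (∀ i ∈ Finset.Icc 1 N, u ≠ tt i) →
      ContinuousWithinAt z (Icc 0 τ) u) ∧
    ∀ i ∈ Finset.Icc 1 N, ContinuousWithinAt z (Iic (tt i)) (tt i) ∧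
      ∃ l : E, Tendsto z (nhdsWithin (tt i) (Ioi (tt i))) (nhds l) := by
  have hη : ∀ i, ∃ η : ℝ → E, i ≤ N → Continuous η ∧
      (∀ t ∈ Ioc (tt i) (tt (i + 1)), z t = η t) ∧ (tt i = ss i → η = ζ i) := by
    intro i
    by_cases hi : i ≤ N
    · rcases (hts i hi).1.lt_or_eq with h | h
      · refine ⟨fun t => if t ≤ ss i then 0 else ζ i t, fun _ => ⟨?_, fun t ht => ?_,
          fun h' => absurd h' h.ne⟩⟩
        · exact continuous_const.if_le (hζ i hi) continuous_id continuous_const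
            fun t (ht : t = ss i) => by rw [ht, hζs i hi h]
        · by_cases h' : t ≤ ss i
          · simpa [h'] using hz0 i hi t ⟨ht.1, h'⟩
          · simpa [h'] using hz i hi t ⟨not_le.1 h', ht.2⟩
      · exact ⟨ζ i, fun _ => ⟨hζ i hi, fun t ht => hz i hi t (h ▸ ht), fun _ => rfl⟩⟩
    · exact ⟨0, fun h => absurd h hi⟩
  choose η hη using hη
  have hlt : ∀ i ≤ N, tt i < tt (i + 1) := fun i hi => (hts i hi).1.trans_lt (hts i hi).2
  refine ⟨fun u hu hut => ?_, fun i hi => ⟨?_, ?_⟩⟩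
  · rcases hu.1.eq_or_lt with rfl | hu0
    · obtain ⟨hc, he, h1⟩ := hη 0 (Nat.zero_le N)
      have h1' := h1 (htt0.trans hss0.symm)
      refine hc.continuousWithinAt.congr_of_eventuallyEq ?_ (by rw [h0, h1'])
      have hpos := hlt 0 (Nat.zero_le N)
      rw [htt0] at hpos
      filter_upwards [self_mem_nhdsWithin, mem_nhdsWithin_of_mem_nhds (Iio_mem_nhds hpos)]
        with t ht ht1
      rcases ht.1.eq_or_lt with rfl | ht0
      · rw [h0, h1']
      · exact he t ⟨by rwa [htt0], le_of_lt ht1⟩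
    · obtain ⟨i, hi, hui⟩ := exists_mem_Ioc_succ (a := tt) (by rwa [htt0]) (hu.2.trans_eq hτ.symm)
      obtain ⟨hc, he, -⟩ := hη i (Nat.le_of_lt_succ hi)
      refine hc.continuousWithinAt.congr_of_eventuallyEq ?_ (he u hui)
      rcases hui.2.lt_or_eq with h | h
      · filter_upwards [mem_nhdsWithin_of_mem_nhds (Ioo_mem_nhds hui.1 h)] with t ht
        exact he t ⟨ht.1, ht.2.le⟩
      · have hiN : i = N := by
          by_contra hne
          exact hut (i + 1) (Finset.mem_Icc.2 ⟨by omega, by omega⟩) h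
        filter_upwards [self_mem_nhdsWithin, mem_nhdsWithin_of_mem_nhds (Ioi_mem_nhds hui.1)]
          with t ht ht1
        exact he t ⟨ht1, by rw [hiN, hτ]; exact ht.2⟩
  · obtain ⟨h1, hN⟩ := Finset.mem_Icc.1 hi
    obtain ⟨j, rfl⟩ : ∃ j, i = j + 1 := ⟨i - 1, by omega⟩
    obtain ⟨hc, he, -⟩ := hη j (by omega)
    have hj := hlt j (by omega)
    refine hc.continuousWithinAt.congr_of_eventuallyEq ?_ (he _ ⟨hj, le_rfl⟩)
    filter_upwards [self_mem_nhdsWithin, mem_nhdsWithin_of_mem_nhds (Ioi_mem_nhds hj)]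
      with t ht ht1
    exact he t ⟨ht1, ht⟩
  · obtain ⟨h1, hN⟩ := Finset.mem_Icc.1 hi
    obtain ⟨hc, he, -⟩ := hη i hN
    refine ⟨η i (tt i), (hc.tendsto (tt i)).mono_left nhdsWithin_le_nhds |>.congr' ?_⟩
    filter_upwards [self_mem_nhdsWithin, mem_nhdsWithin_of_mem_nhds (Iio_mem_nhds (hlt i hN))]
      with t ht ht1
    exact (he t ⟨ht, le_of_lt ht1⟩).symm

theorem BddOn.le_supOn {E : Type*} [NormedAddCommGroup E] {a b : ℝ} {w : ℝ → E}
    (hw : BddOn a b w) {u : ℝ} (hu : u ∈ Icc a b) : ‖w u‖ ≤ supOn a b w := by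
  obtain ⟨C, hC⟩ := hw
  exact le_ciSup (f := fun u : Icc a b => ‖w u.1‖)
    ⟨C, by rintro _ ⟨v, rfl⟩; exact hC v v.2⟩ ⟨u, hu⟩

theorem supOn_le {E : Type*} [NormedAddCommGroup E] {a b C : ℝ} (hab : a ≤ b) {w : ℝ → E}
    (hw : ∀ u ∈ Icc a b, ‖w u‖ ≤ C) : supOn a b w ≤ C := by
  have : Nonempty (Icc a b) := ⟨⟨a, left_mem_Icc.2 hab⟩⟩
  exact ciSup_le fun u => hw u u.2

theorem supOn_nonneg {E : Type*} [NormedAddCommGroup E] (a b : ℝ) (w : ℝ → E) :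
    0 ≤ supOn a b w :=
  Real.iSup_nonneg fun _ => norm_nonneg _

/-- Matrices act on `Fin n → ℝ` by continuous linear maps. -/
noncomputable def mulVecCLM (n : ℕ) :
    Matrix (Fin n) (Fin n) ℝ →ₗ[ℝ] (Fin n → ℝ) →L[ℝ] (Fin n → ℝ) :=
  (LinearMap.toContinuousLinearMap.toLinearMap).comp (Matrix.toLin' : _ ≃ₗ[ℝ] _).toLinearMap

theorem mulVecCLM_apply {n : ℕ} (B : Matrix (Fin n) (Fin n) ℝ) (x : Fin n → ℝ) :
    mulVecCLM n B x = B *ᵥ x := rfl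

theorem continuous_mulVecCLM (n : ℕ) : Continuous (mulVecCLM n) :=
  LinearMap.continuous_of_finiteDimensional _

theorem Continuous.matrix_inv_of_isUnit {X : Type*} [TopologicalSpace X] {n : ℕ}
    {B : X → Matrix (Fin n) (Fin n) ℝ} (hB : Continuous B) (hu : ∀ x, IsUnit (B x)) :
    Continuous fun x => (B x)⁻¹ := by
  simp_rw [Matrix.inv_def, Ring.inverse_eq_inv']
  refine (hB.matrix_det.inv₀ fun x => ?_).smul hB.matrix_adjugate
  exact ((Matrix.isUnit_iff_isUnit_det _).1 (hu x)).ne_zero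

/-- **Existence.** Under (H1), (H2) and (H3), with continuous impulse maps and
integrable superpositions, the impulsive semi-linear system has at least one
solution `z` on `[−r,τ]`, lying in the ball `D_ρ` around `φ̃` and satisfying
the variation-of-constants integral equations. -/
theorem existence_of_solutions
    (n N q : ℕ) (hn : 1 ≤ n)
    (r τ : ℝ) (hr : 0 < r) (hτ : 0 < τ)
    (tt ss : ℕ → ℝ) (htt0 : tt 0 = 0) (hss0 : ss 0 = 0) (htt1 : 0 < tt 1)
    (hts : ∀ i ∈ Finset.Icc 1 N, tt i ≤ ss i ∧ ss i < tt (i + 1))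
    (httN : tt (N + 1) = τ)
    (θ : ℕ → ℝ) (hθ : ∀ j ∈ Finset.Icc 1 q, 0 < θ j ∧ θ j < τ)
    (hθmono : ∀ j ∈ Finset.Icc 1 (q - 1), θ j < θ (j + 1))
    (A : ℝ → Matrix (Fin n) (Fin n) ℝ) (hA : Continuous A)
    (Φ : ℝ → Matrix (Fin n) (Fin n) ℝ)
    (hΦderiv : ∀ t : ℝ, ∀ i j : Fin n,
      HasDerivAt (fun u => Φ u i j) ((A t * Φ t) i j) t)
    (hΦ0 : Φ 0 = 1) (hΦinv : ∀ t, IsUnit (Φ t))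
    (U : ℝ → ℝ → Matrix (Fin n) (Fin n) ℝ)
    (hU : ∀ t s : ℝ, U t s = Φ t * (Φ s)⁻¹)
    (M : ℝ) (hM : 1 ≤ M)
    (hUbd : ∀ t s : ℝ, 0 ≤ s → s ≤ t → t ≤ τ →
      ∀ x : Fin n → ℝ, ‖U t s *ᵥ x‖ ≤ M * ‖x‖)
    -- (H1)
    (Nq L : ℝ) (hNq : 0 < Nq) (hL : 0 < L) (hNqL : L + Nq * (q : ℝ) < 1 / 2)
    (g : (Fin q → ℝ → (Fin n → ℝ)) → ℝ → (Fin n → ℝ))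
    (hg0 : g (fun _ _ => 0) = fun _ => 0)
    (hglip : ∀ y z : Fin q → ℝ → (Fin n → ℝ), ∀ u ∈ Set.Icc (-r) (0 : ℝ),
      ‖g y u - g z u‖ ≤ Nq * ∑ j : Fin q, ‖y j u - z j u‖)
    (G : ℕ → ℝ → (Fin n → ℝ) → (Fin n → ℝ))
    (hG0 : ∀ i ∈ Finset.Icc 1 N, ∀ u : ℝ, G i u 0 = 0)
    (hGlip : ∀ i ∈ Finset.Icc 1 N, ∀ (u : ℝ) (x y : Fin n → ℝ),
      ‖G i u x - G i u y‖ ≤ L * ‖x - y‖)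
    -- (H2)
    (f : ℝ → (ℝ → (Fin n → ℝ)) → (Fin n → ℝ))
    (K : ℝ → ℝ → ℝ) (Ψ : ℝ → ℝ)
    (hKcont : Continuous fun p : ℝ × ℝ => K p.1 p.2)
    (hKmono : ∀ a a' b b' : ℝ, a ≤ a' → b ≤ b' → K a b ≤ K a' b')
    (hKnonneg : ∀ a b : ℝ, 0 ≤ K a b)
    (hΨcont : Continuous Ψ) (hΨmono : Monotone Ψ) (hΨnonneg : ∀ a : ℝ, 0 ≤ Ψ a)
    (hflip : ∀ u ∈ Set.Icc (0 : ℝ) τ, ∀ φ₁ φ₂ : ℝ → (Fin n → ℝ),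
      BddOn (-r) 0 φ₁ → BddOn (-r) 0 φ₂ →
      ‖f u φ₁ - f u φ₂‖ ≤ K (supOn (-r) 0 φ₁) (supOn (-r) 0 φ₂) * supOn (-r) 0 (φ₁ - φ₂))
    (hfbd : ∀ u ∈ Set.Icc (0 : ℝ) τ, ∀ φ' : ℝ → (Fin n → ℝ),
      BddOn (-r) 0 φ' → ‖f u φ'‖ ≤ Ψ (supOn (-r) 0 φ'))
    -- continuity of the impulse maps
    (hGcont : ∀ i ∈ Finset.Icc 1 N,
      Continuous fun p : ℝ × (Fin n → ℝ) => G i p.1 p.2)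
    -- integrability of the superposition for every bounded input
    (hfint : ∀ y : ℝ → (Fin n → ℝ), BddOn (-r) τ y →
      IntervalIntegrable (fun u => f u (fun v => y (u + v))) volume 0 τ)
    -- data: continuous history φ and the vectors α, β of φ̃
    (φ : ℝ → (Fin n → ℝ)) (hφcont : ContinuousOn φ (Set.Icc (-r) 0))
    (α β : Fin n → ℝ) (ρ : ℝ) (hρ : 0 < ρ)
    -- φ̃, characterized by its defining piecewise equations
    (φt : ℝ → (Fin n → ℝ))
    (hφt1 : ∀ u ∈ Set.Ioc (0 : ℝ) (tt 1), φt u = U u 0 *ᵥ φ 0)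
    (hφt2 : ∀ i ∈ Finset.Icc 1 N, ∀ u ∈ Set.Ioc (ss i) (tt (i + 1)), φt u = α)
    (hφt3 : ∀ i ∈ Finset.Icc 1 N, ∀ u ∈ Set.Ioc (tt i) (ss i), φt u = β)
    (hφt4 : ∀ u ∈ Set.Icc (-r) (0 : ℝ), φt u = φ u)
    -- (H3)
    (h3i : M * Nq * (q : ℝ) * (supOn (-r) τ φt + ρ)
        + M * τ * Ψ (supOn (-r) τ φt + ρ) ≤ ρ)
    (h3ii : M * L * (supOn (-r) τ φt + ρ) + ‖α‖
        + M * τ * Ψ (supOn (-r) τ φt + ρ) ≤ ρ)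
    (h3iii : L * (supOn (-r) τ φt + ρ) + ‖β‖ ≤ ρ) :
    ∃ z : ℝ → (Fin n → ℝ),
      (∀ u ∈ Set.Icc (-r) τ, ‖z u - φt u‖ ≤ ρ) ∧
      (∀ u ∈ Set.Icc (0 : ℝ) τ, (∀ i ∈ Finset.Icc 1 N, u ≠ tt i) →
        ContinuousWithinAt z (Set.Icc 0 τ) u) ∧
      (∀ i ∈ Finset.Icc 1 N,
        ContinuousWithinAt z (Set.Iic (tt i)) (tt i) ∧
        ∃ l : Fin n → ℝ,
          Filter.Tendsto z (nhdsWithin (tt i) (Set.Ioi (tt i))) (nhds l)) ∧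
      (∀ u ∈ Set.Ioc (0 : ℝ) (tt 1), z u =
        U u 0 *ᵥ (φ 0 - g (fun j w => z (θ (j.1 + 1) + w)) 0)
          + ∫ v in (0 : ℝ)..u, U u v *ᵥ f v (fun w => z (v + w))) ∧
      (∀ i ∈ Finset.Icc 1 N, ∀ u ∈ Set.Ioc (ss i) (tt (i + 1)), z u =
        U u (ss i) *ᵥ G i (ss i) (z (ss i))
          + ∫ v in (ss i)..u, U u v *ᵥ f v (fun w => z (v + w))) ∧
      (∀ i ∈ Finset.Icc 1 N, ∀ u ∈ Set.Ioc (tt i) (ss i), z u = G i u (z u)) ∧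
      (∀ u ∈ Set.Icc (-r) (0 : ℝ),
        z u = φ u - g (fun j w => z (θ (j.1 + 1) + w)) u) := by
  have hle : ∀ i ≤ N, tt i ≤ ss i ∧ ss i < tt (i + 1) := by
    intro i hi
    rcases Nat.eq_zero_or_pos i with rfl | h
    · rw [htt0, hss0]
      exact ⟨le_rfl, htt1⟩
    · exact hts i (Finset.mem_Icc.2 ⟨h, hi⟩)
  have hmono : ∀ {i j}, i ≤ j → j ≤ N + 1 → tt i ≤ tt j := fun hij hj =>
    le_of_forall_le_succ (fun i hi => ((hle i hi).1.trans_lt (hle i hi).2).le) hij hj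
  have hss_nonneg : ∀ i ≤ N, 0 ≤ ss i := fun i hi =>
    (htt0 ▸ hmono (Nat.zero_le i) (by omega)).trans (hle i hi).1
  have htt_le : ∀ i ≤ N, tt (i + 1) ≤ τ := fun i hi => httN ▸ hmono (by omega) le_rfl
  have htt1' : tt 1 ≤ τ := htt_le 0 (Nat.zero_le N)
  have hcover : ∀ u ∈ Ioc 0 τ, (∀ i ≤ N, u ∉ Ioc (ss i) (tt (i + 1))) →
      ∃ i ∈ Finset.Icc 1 N, u ∈ Ioc (tt i) (ss i) := by
    intro u hu hui
    obtain ⟨i, hi, hu'⟩ := exists_mem_Ioc_succ (a := tt) (by rw [htt0]; exact hu.1)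
      (hu.2.trans_eq httN.symm)
    have hi' : i ≤ N := Nat.le_of_lt_succ hi
    have hus : u ≤ ss i := not_lt.1 fun h => hui i hi' ⟨h, hu'.2⟩
    refine ⟨i, Finset.mem_Icc.2 ⟨Nat.one_le_iff_ne_zero.2 ?_, hi'⟩, hu'.1, hus⟩
    rintro rfl
    rw [htt0] at hu'
    rw [hss0] at hus
    exact absurd hu'.1 (not_lt.2 hus)
  have h0r : (0 : ℝ) ∈ Icc (-r) 0 := ⟨by linarith, le_rfl⟩
  have hUP : ∀ t s x, U t s *ᵥ x = mulVecCLM n (Φ t) (mulVecCLM n (Φ s)⁻¹ x) := fun t s x => by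
    rw [hU, mulVecCLM_apply, mulVecCLM_apply, Matrix.mulVec_mulVec]
  have hφtbdd : BddOn (-r) τ φt := by
    obtain ⟨B, hB⟩ := isCompact_Icc.exists_bound_of_continuousOn hφcont
    have hB0 : 0 ≤ B := (norm_nonneg _).trans (hB 0 h0r)
    have hM0 : 0 ≤ M * ‖φ 0‖ := by positivity
    refine ⟨B + M * ‖φ 0‖ + ‖α‖ + ‖β‖, fun u hu => ?_⟩
    have hα0 := norm_nonneg α
    have hβ0 := norm_nonneg β
    by_cases hu0 : u ≤ 0
    · rw [hφt4 u ⟨hu.1, hu0⟩]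
      linarith [hB u ⟨hu.1, hu0⟩]
    · by_cases hs : ∃ i ≤ N, u ∈ Ioc (ss i) (tt (i + 1))
      · obtain ⟨i, hi, hui⟩ := hs
        rcases Nat.eq_zero_or_pos i with rfl | hpos
        · rw [hss0] at hui
          rw [hφt1 u hui]
          linarith [hUbd u 0 le_rfl hui.1.le (hui.2.trans htt1') (φ 0)]
        · rw [hφt2 i (Finset.mem_Icc.2 ⟨hpos, hi⟩) u hui]
          linarith
      · push Not at hs
        obtain ⟨i, hi, hui⟩ := hcover u ⟨not_le.1 hu0, hu.2⟩ hs
        rw [hφt3 i hi u hui]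
        linarith
  set S := supOn (-r) τ φt
  have hφtS : ∀ u ∈ Icc (-r) τ, ‖φt u‖ ≤ S := fun u hu => hφtbdd.le_supOn hu
  have hS0 : 0 ≤ S := supOn_nonneg _ _ _
  have hM0 : 0 ≤ M := by linarith
  have hq0 : (0 : ℝ) ≤ q := Nat.cast_nonneg q
  have hΨR : 0 ≤ M * τ * Ψ (S + ρ) := by
    have := hΨnonneg (S + ρ)
    positivity
  have hMNq : 0 ≤ M * Nq * q := by positivity
  have hML : 0 ≤ M * L := by positivity
  by_cases hκ : M * Nq * q < 1 ∧ M * L < 1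
  swap
  · have hdeg : S = 0 ∧ Ψ (S + ρ) = 0 := by
      have hα0 := norm_nonneg α
      have hsum : S + M * τ * Ψ (S + ρ) ≤ 0 := by
        rcases not_and_or.1 hκ with h | h
        · nlinarith [not_lt.1 h]
        · nlinarith [not_lt.1 h]
      have hMτ : 0 < M * τ := by positivity
      refine ⟨by linarith, ?_⟩
      have h0 : M * τ * Ψ (S + ρ) = 0 := by linarith
      exact (mul_eq_zero.1 h0).resolve_left hMτ.ne'
    have hφt0 : ∀ u ∈ Icc (-r) τ, φt u = 0 := fun u hu =>
      norm_le_zero_iff.1 (hdeg.1 ▸ hφtS u hu)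
    have hφ0 : ∀ u ∈ Icc (-r) 0, φ u = 0 := fun u hu => by
      rw [← hφt4 u hu, hφt0 u ⟨hu.1, hu.2.trans hτ.le⟩]
    have hf0 : ∀ v ∈ Icc 0 τ, f v (fun _ => 0) = 0 := by
      intro v hv
      have h1 := hfbd v hv (fun _ => 0) ⟨0, fun u _ => by simp⟩
      have h2 : supOn (-r) 0 (fun _ : ℝ => (0 : Fin n → ℝ)) ≤ S + ρ :=
        supOn_le h0r.1 fun u _ => by rw [norm_zero]; linarith
      exact norm_le_zero_iff.1 ((h1.trans (hΨmono h2)).trans_eq hdeg.2)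
    have hint0 : ∀ u ∈ Icc 0 τ, ∀ s ∈ Icc 0 τ, ∫ v in s..u, U u v *ᵥ f v (fun _ => 0) = 0 := by
      intro u hu s hs
      refine intervalIntegral.integral_zero_ae (Eventually.of_forall fun v hv => ?_)
      have hv' : v ∈ uIcc 0 τ := uIcc_subset_uIcc (by rwa [uIcc_of_le hτ.le])
        (by rwa [uIcc_of_le hτ.le]) (uIoc_subset_uIcc hv)
      rw [uIcc_of_le hτ.le] at hv'
      rw [hf0 v hv', Matrix.mulVec_zero]
    refine ⟨fun _ => 0, fun u hu => ?_, fun _ _ _ => continuousWithinAt_const,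
      fun i _ => ⟨continuousWithinAt_const, 0, tendsto_const_nhds⟩, fun u hu => ?_,
      fun i hi u hu => ?_, fun i hi u _ => (hG0 i hi u).symm, fun u hu => ?_⟩
    · rw [hφt0 u hu, sub_zero, norm_zero]
      exact hρ.le
    · rw [hint0 u ⟨hu.1.le, hu.2.trans htt1'⟩ 0 (left_mem_Icc.2 hτ.le), hφ0 0 h0r, hg0]
      simp
    · have hiN := (Finset.mem_Icc.1 hi).2
      have hs0 := hss_nonneg i hiN
      have huτ := hu.2.trans (htt_le i hiN)
      rw [hint0 u ⟨hs0.trans hu.1.le, huτ⟩ (ss i) ⟨hs0, hu.1.le.trans huτ⟩, hG0 i hi]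
      simp
    · rw [hφ0 u hu, hg0]
      simp
  have hΦcont : Continuous Φ := continuous_matrix fun i j =>
    continuous_iff_continuousAt.2 fun t => (hΦderiv t i j).continuousAt
  have hdet : ∀ t, IsUnit (Φ t).det := fun t => (Matrix.isUnit_iff_isUnit_det _).1 (hΦinv t)
  set κ := max (M * Nq * q) (M * L)
  have hgy : ∀ (y y' : ℝ → Fin n → ℝ) C, (∀ t, ‖y t - y' t‖ ≤ C) → ∀ u ∈ Icc (-r) (0 : ℝ),
      ‖g (fun j w => y (θ (j.1 + 1) + w)) u - g (fun j w => y' (θ (j.1 + 1) + w)) u‖ ≤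
        Nq * (q * C) := by
    intro y y' C hy u hu
    refine (hglip _ _ u hu).trans (mul_le_mul_of_nonneg_left ?_ hNq.le)
    refine (Finset.sum_le_card_nsmul _ _ C fun j _ => hy _).trans_eq ?_
    simp
  have hgy0 : ∀ (y : ℝ → Fin n → ℝ) C, (∀ t, ‖y t‖ ≤ C) → ∀ u ∈ Icc (-r) (0 : ℝ),
      ‖g (fun j w => y (θ (j.1 + 1) + w)) u‖ ≤ Nq * (q * C) := by
    intro y C hy u hu
    have h1 := hgy y (fun _ => 0) C (fun t => by simpa using hy t) u hu
    simpa [hg0] using h1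
  let c : ℕ → (ℝ → Fin n → ℝ) → Fin n → ℝ := fun i y =>
    if i = 0 then φ 0 - g (fun j w => y (θ (j.1 + 1) + w)) 0 else G i (ss i) (y (ss i))
  let p : ℝ → Fin n → ℝ := (Icc (-r) τ).indicator φt
  have hpt : ∀ u ∈ Icc (-r) τ, p u = φt u := fun u hu => indicator_of_mem hu _
  have hpS : ∀ t, ‖p t‖ + ρ ≤ S + ρ := by
    intro t
    by_cases ht : t ∈ Icc (-r) τ
    · rw [hpt t ht]
      linarith [hφtS t ht]
    · simp only [p]
      rw [indicator_of_notMem ht, norm_zero]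
      linarith
  have hballR : ∀ y : ℝ → Fin n → ℝ, (∀ t, ‖y t - p t‖ ≤ ρ) → ∀ t, ‖y t‖ ≤ S + ρ :=
    fun y hy t => by linarith [norm_le_norm_add_norm_sub' (y t) (p t), hy t, hpS t]
  have hshift : ∀ (y : ℝ → Fin n → ℝ) C, (∀ t, ‖y t‖ ≤ C) → ∀ v,
      BddOn (-r) 0 (fun w => y (v + w)) ∧ supOn (-r) 0 (fun w => y (v + w)) ≤ C :=
    fun y C hy v => ⟨⟨C, fun u _ => hy _⟩, supOn_le h0r.1 fun u _ => hy _⟩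
  have hinv_mul : ∀ t x, mulVecCLM n (Φ t)⁻¹ (mulVecCLM n (Φ t) x) = x := fun t x => by
    rw [mulVecCLM_apply, mulVecCLM_apply, Matrix.mulVec_mulVec,
      Matrix.nonsing_inv_mul _ (hdet t), Matrix.one_mulVec]
  have hmul_inv : ∀ t x, mulVecCLM n (Φ t) (mulVecCLM n (Φ t)⁻¹ x) = x := fun t x => by
    rw [mulVecCLM_apply, mulVecCLM_apply, Matrix.mulVec_mulVec,
      Matrix.mul_nonsing_inv _ (hdet t), Matrix.one_mulVec]
  have hdisj : ∀ i ≤ N, ∀ j ≤ N, ∀ t, t ∈ Ioc (ss i) (tt (i + 1)) →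
      t ∈ Ioc (ss j) (tt (j + 1)) → i = j := by
    have key : ∀ i j, i < j → j ≤ N → ∀ t, t ≤ tt (i + 1) → ss j < t → False :=
      fun i j hij hj t h1 h2 => absurd (h1.trans ((hmono (by omega) (by omega)).trans (hle j hj).1))
        (not_le.2 h2)
    intro i hi j hj t h1 h2
    rcases lt_trichotomy i j with h | h | h
    · exact (key i j h hj t h1.2 h2.1).elim
    · exact h
    · exact (key j i h hi t h2.2 h1.1).elim
  have hgap : ∀ i ≤ N, ∀ u ∈ Ioc (tt i) (ss i), u ∉ Icc (-r) 0 ∧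
      ∀ j ≤ N, u ∉ Ioc (ss j) (tt (j + 1)) := by
    intro i hi u hu
    have h0 : 0 ≤ tt i := htt0 ▸ hmono (Nat.zero_le i) (by omega)
    refine ⟨fun h => absurd (h0.trans_lt hu.1) (not_lt.2 h.2), fun j hj h => ?_⟩
    rcases lt_trichotomy i j with hij | rfl | hij
    · linarith [hu.2, (hle i hi).2, hmono (i := i + 1) hij (by omega), (hle j hj).1, h.1]
    · linarith [hu.2, h.1]
    · linarith [hu.1, h.2, hmono (i := j + 1) hij (by omega)]
  obtain ⟨z, ζ, hzp, hzh, hzc, hz0⟩ := exists_segmentwise_mild_solution (r := r) hτ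
    (P := fun t => mulVecCLM n (Φ t)) (Q := fun t => mulVecCLM n (Φ t)⁻¹)
    ((continuous_mulVecCLM n).comp hΦcont)
    ((continuous_mulVecCLM n).comp (hΦcont.matrix_inv_of_isUnit hΦinv)) hmul_inv hinv_mul hM0
    (fun t s hs hst ht x => by rw [← hUP]; exact hUbd t s hs hst ht x)
    hss_nonneg htt_le hdisj
    (fun y u => φ u - g (fun j w => y (θ (j.1 + 1) + w)) u) c
    (κ := κ) (hMNq.trans (le_max_left _ _)) (max_lt hκ.1 hκ.2)
    (fun y y' C hC hy u hu => by
      rw [sub_sub_sub_cancel_left, norm_sub_rev]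
      calc _ ≤ Nq * (q * C) := hgy y y' C hy u hu
        _ ≤ M * (Nq * (q * C)) := le_mul_of_one_le_left (by positivity) hM
        _ = M * Nq * q * C := by ring
        _ ≤ κ * C := mul_le_mul_of_nonneg_right (le_max_left _ _) hC)
    (fun i hi y y' C hC hy => by
      by_cases h : i = 0
      · simp only [c, if_pos h]
        rw [sub_sub_sub_cancel_left, norm_sub_rev]
        calc _ ≤ M * (Nq * (q * C)) := mul_le_mul_of_nonneg_left (hgy y y' C hy 0 h0r) hM0
          _ = M * Nq * q * C := by ring
          _ ≤ κ * C := mul_le_mul_of_nonneg_right (le_max_left _ _) hC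
      · simp only [c, if_neg h]
        have hi' : i ∈ Finset.Icc 1 N := Finset.mem_Icc.2 ⟨Nat.one_le_iff_ne_zero.2 h, hi⟩
        calc _ ≤ M * (L * C) := mul_le_mul_of_nonneg_left
              ((hGlip i hi' _ _ _).trans (mul_le_mul_of_nonneg_left (hy _) hL.le)) hM0
          _ = M * L * C := by ring
          _ ≤ κ * C := mul_le_mul_of_nonneg_right (le_max_right _ _) hC)
    (by
      obtain ⟨B, hB⟩ := isCompact_Icc.exists_bound_of_continuousOn hφcont
      refine ⟨B, fun u hu => ?_⟩
      simpa [hg0] using hB u hu)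
    p (ρ := ρ) (R := S + ρ) (D := Ψ (S + ρ)) hρ.le hpS (hΨnonneg _)
    (fun y hy u hu => by
      rw [hpt u ⟨hu.1, hu.2.trans hτ.le⟩, hφt4 u hu, sub_sub_cancel_left, norm_neg]
      calc _ ≤ Nq * (q * (S + ρ)) := hgy0 y _ (hballR y hy) u hu
        _ ≤ M * (Nq * (q * (S + ρ))) := le_mul_of_one_le_left (by positivity) hM
        _ = M * Nq * q * (S + ρ) := by ring
        _ ≤ ρ := by linarith)
    (fun y hy i hi t ht => by
      have hs0 := hss_nonneg i hi
      have htτ : t ≤ τ := ht.2.trans (htt_le i hi)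
      rw [hpt t ⟨by linarith [ht.1], htτ⟩, ← hUP]
      by_cases h : i = 0
      · subst h
        simp only [c, if_pos]
        rw [hss0] at ht ⊢
        rw [hφt1 t ht, ← Matrix.mulVec_sub, sub_sub_cancel_left]
        have h1 := hUbd t 0 le_rfl ht.1.le htτ (-g (fun j w => y (θ (j.1 + 1) + w)) 0)
        rw [norm_neg] at h1
        have h2 := mul_le_mul_of_nonneg_left (hgy0 y _ (hballR y hy) 0 h0r) hM0
        linarith
      · simp only [c, if_neg h]
        have hi' : i ∈ Finset.Icc 1 N := Finset.mem_Icc.2 ⟨Nat.one_le_iff_ne_zero.2 h, hi⟩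
        rw [hφt2 i hi' t ht]
        have h1 := hUbd t (ss i) hs0 ht.1.le htτ (G i (ss i) (y (ss i)))
        have h2 : ‖G i (ss i) (y (ss i))‖ ≤ L * (S + ρ) := by
          have h3 := hGlip i hi' (ss i) (y (ss i)) 0
          rw [hG0 i hi', sub_zero, sub_zero] at h3
          exact h3.trans (mul_le_mul_of_nonneg_left (hballR y hy _) hL.le)
        have h3 := mul_le_mul_of_nonneg_left h2 hM0
        linarith [norm_sub_le (U t (ss i) *ᵥ G i (ss i) (y (ss i))) α])
    (fun t ht hti => by
      by_cases htr : t ∈ Icc (-r) τ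
      · obtain ⟨i, hi, hti'⟩ := hcover t
          ⟨not_le.1 fun h => ht ⟨htr.1, h⟩, htr.2⟩ hti
        rw [hpt t htr, hφt3 i hi t hti']
        have : 0 ≤ L * (S + ρ) := by positivity
        linarith
      · simp only [p]
        rw [indicator_of_notMem htr, norm_zero]
        exact hρ.le)
    (fun y v => f v (fun w => y (v + w)))
    (fun y ⟨B, hB⟩ => hfint y ⟨B, fun u _ => hB u⟩)
    (fun y hy v hv => (hfbd v hv _ (hshift y _ hy v).1).trans (hΨmono (hshift y _ hy v).2))
    (Λ := K (S + ρ) (S + ρ)) (hKnonneg _ _)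
    (fun y y' hy hy' C hC hyy v hv => by
      obtain ⟨h1, h2⟩ := hshift y _ hy v
      obtain ⟨h1', h2'⟩ := hshift y' _ hy' v
      refine (hflip v hv _ _ h1 h1').trans (mul_le_mul (hKmono _ _ _ _ h2 h2') ?_
        (supOn_nonneg _ _ _) (hKnonneg _ _))
      exact supOn_le h0r.1 fun u _ => hyy _)
  have hzgap : ∀ i ≤ N, ∀ u ∈ Ioc (tt i) (ss i), z u = 0 := fun i hi u hu =>
    hz0 u (hgap i hi u hu).1 (hgap i hi u hu).2
  have hc0 : c 0 z = z 0 := (hzh 0 h0r).symm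
  obtain ⟨hcont, hcont'⟩ := continuousWithinAt_of_segmentwise hle htt0 hss0 httN
    (fun i hi => (hzc i hi).1) (fun i hi t ht => ((hzc i hi).2.2 t ht).1) hzgap
    (by have h := (hzc 0 (Nat.zero_le N)).2.1; rw [hss0] at h; rw [h, hc0])
    (fun i hi hlt => by
      have hne : i ≠ 0 := by
        rintro rfl
        exact absurd hlt (by rw [htt0, hss0]; exact lt_irrefl 0)
      rw [(hzc i hi).2.1]
      simp only [c, if_neg hne]
      rw [hzgap i hi (ss i) ⟨hlt, le_rfl⟩,
        hG0 i (Finset.mem_Icc.2 ⟨Nat.one_le_iff_ne_zero.2 hne, hi⟩)])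
  refine ⟨z, fun u hu => hpt u hu ▸ hzp u, hcont, hcont', fun u hu => ?_, fun i hi u hu => ?_,
    fun i hi u hu => ?_, hzh⟩
  · have h := ((hzc 0 (Nat.zero_le N)).2.2 u (by rwa [hss0])).2
    rw [hss0] at h
    simp only [hUP]
    exact h
  · have hi' := Finset.mem_Icc.1 hi
    have h := ((hzc i hi'.2).2.2 u hu).2
    simp only [c, if_neg (Nat.one_le_iff_ne_zero.1 hi'.1)] at h
    simp only [hUP]
    exact h
  · rw [hzgap i (Finset.mem_Icc.1 hi).2 u hu, hG0 i hi]
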